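/- arXiv:math/0205333 — 10 statements merged into one kernel-verified Lean document; each statement's English description precedes it below -/
import Mathlib

section
/- Let E be a complex Hilbert space and N ≥ 1. (i) For all Z, Z' ∈ B_N(E) and all e, f ∈ E, the family (⟨(Z'_σ)^* f, (Z_σ)^* e⟩)_{σ∈F_N^+} is summable; denote its sum by ⟨K_B(Z,Z')f, e⟩. (ii) The Szegő kernel K_B is positive definite on B_N(E): for every m ≥ 1, all Z^1,…,Z^m ∈ B_N(E), and all e_1,…,e_m ∈ E, the number Σ_{i,j=1}^m ⟨K_B(Z^i,Z^j) e_j, e_i⟩ is a nonnegative real. -/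
noncomputable section
open scoped InnerProductSpace ComplexConjugate
open ContinuousLinearMap

/-- Words in `N` letters: the free monoid `F_N^+` on `N` generators. -/
abbrev Word (N : ℕ) := FreeMonoid (Fin N)

variable {E : Type*} [NormedAddCommGroup E] [InnerProductSpace ℂ E] [CompleteSpace E]

/-- The word product `Z_σ = Z_{i_1} ⋯ Z_{i_k}` for `σ = i_1 ⋯ i_k`, with `Z_∅ = I`. -/
def wprod {N : ℕ} (Z : Fin N → E →L[ℂ] E) (σ : Word N) : E →L[ℂ] E :=
  ((FreeMonoid.toList σ).map Z).prod

/-- Membership in the open operator unit ball `B_N(E)`: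
`I − Σ_k Z_k Z_k^*` is positive and invertible. -/
def inBall {N : ℕ} (Z : Fin N → E →L[ℂ] E) : Prop :=
  (1 - ∑ k, Z k * adjoint (Z k)).IsPositive ∧ IsUnit (1 - ∑ k, Z k * adjoint (Z k))


lemma inBall_lower {E : Type*} [NormedAddCommGroup E] [InnerProductSpace ℂ E] [CompleteSpace E]
    {N : ℕ} {Z : Fin N → E →L[ℂ] E} (hZ : inBall Z) :
    ∃ c : ℝ, 0 < c ∧ ∀ e : E, c * ‖e‖ ^ 2 + ∑ k, ‖adjoint (Z k) e‖ ^ 2 ≤ ‖e‖ ^ 2 := by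
  obtain ⟨hp, hu⟩ := hZ
  set A := 1 - ∑ k, Z k * adjoint (Z k) with hA
  have h0 : 0 ≤ A := (ContinuousLinearMap.nonneg_iff_isPositive A).2 hp
  have hsp : IsStrictlyPositive A := hu.isStrictlyPositive h0
  rcases subsingleton_or_nontrivial E with hE | hE
  · refine ⟨1, one_pos, fun e => ?_⟩
    have h0 : ∀ x : E, ‖x‖ = 0 := fun x => by rw [Subsingleton.elim x 0, norm_zero]
    simp [h0]
  obtain ⟨c, hc, hle⟩ := (CFC.exists_pos_algebraMap_le_iff (A := E →L[ℂ] E) (a := A)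
    hsp.isSelfAdjoint).2 (fun x hx => hsp.spectrum_pos hx)
  refine ⟨c, hc, fun e => ?_⟩
  have h1 := ((ContinuousLinearMap.le_def _ _).1 hle).re_inner_nonneg_right e
  have h2 : ∀ k, RCLike.re ⟪e, (Z k) (adjoint (Z k) e)⟫_ℂ = ‖adjoint (Z k) e‖ ^ 2 := by
    intro k
    rw [← ContinuousLinearMap.adjoint_inner_left, inner_self_eq_norm_sq]
  have h3 : (algebraMap ℝ (E →L[ℂ] E) c) e = (c : ℂ) • e := by
    simp [Algebra.algebraMap_eq_smul_one]
  have h4 : RCLike.re ⟪e, (algebraMap ℝ (E →L[ℂ] E) c) e⟫_ℂ = c * ‖e‖ ^ 2 := by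
    rw [h3, inner_smul_right, RCLike.re_to_complex, Complex.re_ofReal_mul,
      ← RCLike.re_to_complex, inner_self_eq_norm_sq]
  have h5 : RCLike.re ⟪e, A e⟫_ℂ = ‖e‖ ^ 2 - ∑ k, ‖adjoint (Z k) e‖ ^ 2 := by
    rw [hA, sub_apply, inner_sub_right, map_sub, sum_apply, inner_sum, map_sum,
      show (1 : E →L[ℂ] E) e = e from rfl, inner_self_eq_norm_sq]
    congr 1
    exact Finset.sum_congr rfl fun k _ => h2 k
  rw [sub_apply, inner_sub_right, map_sub, h4, h5] at h1
  linarith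

/-- Words of length less than `n`. -/
def wordsLT (N : ℕ) : ℕ → Finset (List (Fin N))
  | 0 => ∅
  | n + 1 => insert [] ((Finset.univ ×ˢ wordsLT N n).image fun p => p.1 :: p.2)

lemma mem_wordsLT {N : ℕ} : ∀ (n : ℕ) (l : List (Fin N)), l.length < n → l ∈ wordsLT N n := by
  intro n
  induction n with
  | zero => intro l h; omega
  | succ n ih =>
    intro l h
    cases l with
    | nil => simp [wordsLT]
    | cons a l => simpa [wordsLT] using ih l (by simpa using h)

lemma sum_wordsLT_le {E : Type*} [NormedAddCommGroup E] [InnerProductSpace ℂ E] [CompleteSpace E]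
    {N : ℕ} {Z : Fin N → E →L[ℂ] E} {c : ℝ} (hc : 0 < c)
    (h : ∀ e : E, c * ‖e‖ ^ 2 + ∑ k, ‖adjoint (Z k) e‖ ^ 2 ≤ ‖e‖ ^ 2) (n : ℕ) :
    ∀ e : E, ∑ l ∈ wordsLT N n, ‖adjoint ((l.map Z).prod) e‖ ^ 2 ≤ c⁻¹ * ‖e‖ ^ 2 := by
  induction n with
  | zero => intro e; simp only [wordsLT, Finset.sum_empty]; positivity
  | succ n ih =>
    intro e
    have hinj : Function.Injective fun p : Fin N × List (Fin N) => p.1 :: p.2 := by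
      rintro ⟨a, l⟩ ⟨b, m⟩ hh
      simpa using hh
    rw [wordsLT, Finset.sum_insert (by simp), Finset.sum_image hinj.injOn, Finset.sum_product]
    have h1 : ∀ k, ∑ l ∈ wordsLT N n, ‖adjoint (((k :: l).map Z).prod) e‖ ^ 2
        ≤ c⁻¹ * ‖adjoint (Z k) e‖ ^ 2 := by
      intro k
      refine le_trans (le_of_eq ?_) (ih (adjoint (Z k) e))
      refine Finset.sum_congr rfl fun l _ => ?_
      rw [List.map_cons, List.prod_cons, ContinuousLinearMap.mul_def,
        ContinuousLinearMap.adjoint_comp, comp_apply]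
    have h2 := Finset.sum_le_sum fun k (_ : k ∈ (Finset.univ : Finset (Fin N))) => h1 k
    rw [← Finset.mul_sum] at h2
    have h3 : ‖adjoint ((([] : List (Fin N)).map Z).prod) e‖ = ‖e‖ := by
      rw [List.map_nil, List.prod_nil, ← ContinuousLinearMap.star_eq_adjoint, star_one]
      rfl
    have h4 := mul_le_mul_of_nonneg_left (h e) (inv_pos.2 hc).le
    rw [mul_add, inv_mul_cancel_left₀ hc.ne'] at h4
    rw [h3]
    linarith

lemma summable_sq {E : Type*} [NormedAddCommGroup E] [InnerProductSpace ℂ E] [CompleteSpace E]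
    {N : ℕ} {Z : Fin N → E →L[ℂ] E} (hZ : inBall Z) (e : E) :
    Summable fun σ : Word N => ‖adjoint (wprod Z σ) e‖ ^ 2 := by
  obtain ⟨c, hc, h⟩ := inBall_lower hZ
  refine summable_of_sum_le (c := c⁻¹ * ‖e‖ ^ 2) (fun _ => by positivity) fun u => ?_
  refine le_trans ?_ (sum_wordsLT_le hc h (u.sup (fun σ => σ.toList.length) + 1) e)
  have hsub : u.map FreeMonoid.toList.toEmbedding ⊆
      wordsLT N (u.sup (fun σ => σ.toList.length) + 1) := by
    intro l hl
    obtain ⟨σ, hσ, rfl⟩ := Finset.mem_map.1 hl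
    exact mem_wordsLT _ _ (Nat.lt_succ_of_le
      (Finset.le_sup (f := fun σ : Word N => σ.toList.length) hσ))
  refine le_trans (le_of_eq ?_)
    (Finset.sum_le_sum_of_subset_of_nonneg hsub fun _ _ _ => by positivity)
  rw [Finset.sum_map]
  rfl

lemma summable_coeff {E : Type*} [NormedAddCommGroup E] [InnerProductSpace ℂ E] [CompleteSpace E]
    {N : ℕ} {Z Z' : Fin N → E →L[ℂ] E} (hZ : inBall Z) (hZ' : inBall Z') (e f : E) :
    Summable fun σ : Word N => ⟪(adjoint (wprod Z σ)) e, (adjoint (wprod Z' σ)) f⟫_ℂ := by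
  refine Summable.of_norm_bounded ((summable_sq hZ e).add (summable_sq hZ' f)) fun σ => ?_
  refine (norm_inner_le_norm _ _).trans ?_
  nlinarith [sq_nonneg (‖adjoint (wprod Z σ) e‖ - ‖adjoint (wprod Z' σ) f‖),
    sq_nonneg (‖adjoint (wprod Z σ) e‖), sq_nonneg (‖adjoint (wprod Z' σ) f‖)]

/-- Lemma 4.1(a): (i) the matrix coefficients of the Szegő kernel
`K_B(Z,Z') = Σ_σ Z_σ (Z'_σ)^*` of the unit ball are given by summable families, and
(ii) `K_B` is a positive definite kernel on `B_N(E)`.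
Here `⟨(Z'_σ)^* f, (Z_σ)^* e⟩` (linear in its first entry) is written with Mathlib's
inner product (linear in its second entry) as `⟪(Z_σ)^* e, (Z'_σ)^* f⟫_ℂ`. -/
theorem stmt5 {E : Type*} [NormedAddCommGroup E] [InnerProductSpace ℂ E] [CompleteSpace E]
    {N : ℕ} (hN : 1 ≤ N) :
    (∀ Z Z' : Fin N → E →L[ℂ] E, inBall Z → inBall Z' → ∀ e f : E,
      Summable fun σ : Word N => ⟪(adjoint (wprod Z σ)) e, (adjoint (wprod Z' σ)) f⟫_ℂ) ∧
    (∀ (m : ℕ) (Z : Fin m → Fin N → E →L[ℂ] E), (∀ i, inBall (Z i)) → ∀ e : Fin m → E,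
      (∑ i, ∑ j, ∑' σ : Word N,
          ⟪(adjoint (wprod (Z i) σ)) (e i), (adjoint (wprod (Z j) σ)) (e j)⟫_ℂ).im = 0 ∧
      0 ≤ (∑ i, ∑ j, ∑' σ : Word N,
          ⟪(adjoint (wprod (Z i) σ)) (e i), (adjoint (wprod (Z j) σ)) (e j)⟫_ℂ).re) := by
  refine ⟨fun Z Z' hZ hZ' e f => summable_coeff hZ hZ' e f, fun m Z hZ e => ?_⟩
  have key : (∑ i, ∑ j, ∑' σ : Word N,
      ⟪(adjoint (wprod (Z i) σ)) (e i), (adjoint (wprod (Z j) σ)) (e j)⟫_ℂ)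
      = ((∑' σ : Word N, ‖∑ i, (adjoint (wprod (Z i) σ)) (e i)‖ ^ 2 : ℝ) : ℂ) := by
    have hs := fun i j => summable_coeff (hZ i) (hZ j) (e i) (e j)
    have h1 : ∀ i, ∑ j, ∑' σ : Word N,
        ⟪(adjoint (wprod (Z i) σ)) (e i), (adjoint (wprod (Z j) σ)) (e j)⟫_ℂ
        = ∑' σ : Word N, ∑ j,
          ⟪(adjoint (wprod (Z i) σ)) (e i), (adjoint (wprod (Z j) σ)) (e j)⟫_ℂ :=
      fun i => (Summable.tsum_finsetSum fun j _ => hs i j).symm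
    rw [Finset.sum_congr rfl fun i _ => h1 i,
      ← Summable.tsum_finsetSum fun i _ => summable_sum fun j _ => hs i j, Complex.ofReal_tsum]
    refine tsum_congr fun σ => ?_
    have h2 := inner_self_eq_norm_sq_to_K (𝕜 := ℂ) (∑ i, (adjoint (wprod (Z i) σ)) (e i))
    rw [Complex.ofReal_pow]
    refine Eq.trans ?_ h2
    rw [sum_inner]
    exact Finset.sum_congr rfl fun i _ => (inner_sum _ _ _).symm
  rw [key]
  exact ⟨Complex.ofReal_im _, by rw [Complex.ofReal_re]; exact tsum_nonneg fun _ => by positivity⟩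
end
end

section
/- Let E be an infinite-dimensional complex Hilbert space and N ≥ 1. For every Z ∈ B_N(E) and every e ∈ E, the family ((Z_σ)^* e)_{σ∈F_N^+} is square-summable, i.e. Σ_{σ∈F_N^+} ‖(Z_σ)^* e‖² < ∞, so it defines an element of the Hilbert space ℓ²(F_N^+; E) of square-summable E-valued families indexed by F_N^+. Moreover, the linear span of the set {((Z_σ)^* e)_{σ∈F_N^+} : Z ∈ B_N(E), e ∈ E} is dense in ℓ²(F_N^+; E). -/
noncomputable section
open scoped InnerProductSpace ComplexConjugate
open ContinuousLinearMap

variable {E : Type*} [NormedAddCommGroup E] [InnerProductSpace ℂ E] [CompleteSpace E]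

lemma aux_cons {N : ℕ} (Z : Fin N → E →L[ℂ] E) (k : Fin N) (l : List (Fin N)) (e : E) :
    adjoint (((k :: l).map Z).prod) e = adjoint ((l.map Z).prod) (adjoint (Z k) e) := by
  rw [List.map_cons, List.prod_cons, ContinuousLinearMap.mul_def, adjoint_comp]
  rfl

lemma aux_coercive [Nontrivial E] {N : ℕ} (Z : Fin N → E →L[ℂ] E) (h : inBall Z) :
    ∃ c : ℝ, 0 < c ∧ ∀ x : E, c * ‖x‖ ^ 2 + ∑ k, ‖adjoint (Z k) x‖ ^ 2 ≤ ‖x‖ ^ 2 := by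
  obtain ⟨hp, hu⟩ := h
  have hs : IsStrictlyPositive (1 - ∑ k, Z k * adjoint (Z k)) :=
    hu.isStrictlyPositive ((nonneg_iff_isPositive _).2 hp)
  obtain ⟨c, hc, hle⟩ := (CFC.exists_pos_algebraMap_le_iff hp.isSelfAdjoint).2
    (fun x hx => hs.spectrum_pos hx)
  refine ⟨c, hc, fun x => ?_⟩
  have h1 := ((ContinuousLinearMap.le_def _ _).1 hle).re_inner_nonneg_left x
  have h2 : ∀ k, (⟪(Z k * adjoint (Z k)) x, x⟫_ℂ).re = ‖adjoint (Z k) x‖ ^ 2 := by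
    intro k
    rw [ContinuousLinearMap.mul_def, comp_apply, ← adjoint_inner_right, inner_self_eq_norm_sq_to_K]
    norm_cast
  have h3 : (⟪(algebraMap ℝ (E →L[ℂ] E) c) x, x⟫_ℂ).re = c * ‖x‖ ^ 2 := by
    rw [Algebra.algebraMap_eq_smul_one, smul_apply, one_apply_eq_self, ← Complex.coe_smul,
      inner_smul_left, inner_self_eq_norm_sq_to_K, Complex.conj_ofReal,
      Complex.re_ofReal_mul]
    norm_cast
  have h4 : (⟪x, x⟫_ℂ).re = ‖x‖ ^ 2 := by
    rw [inner_self_eq_norm_sq_to_K]; norm_cast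
  simp only [sub_apply, one_apply_eq_self, sum_apply, inner_sub_left, sum_inner, map_sub,
    map_sum, RCLike.re_to_complex, h2, h3, h4] at h1
  linarith

lemma aux_sum {N : ℕ} (Z : Fin N → E →L[ℂ] E) (c : ℝ) (hc : 0 < c)
    (h : ∀ x : E, c * ‖x‖ ^ 2 + ∑ k, ‖adjoint (Z k) x‖ ^ 2 ≤ ‖x‖ ^ 2) (n : ℕ) :
    ∀ (s : Finset (List (Fin N))), (∀ l ∈ s, l.length ≤ n) → ∀ e : E,
      ∑ l ∈ s, ‖adjoint ((l.map Z).prod) e‖ ^ 2 ≤ ‖e‖ ^ 2 / c := by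
  have hb : ∀ e : E, ‖e‖ ^ 2 ≤ ‖e‖ ^ 2 / c := by
    intro e
    rw [le_div_iff₀ hc]
    have := h e
    have : 0 ≤ ∑ k, ‖adjoint (Z k) e‖ ^ 2 := by positivity
    linarith
  have h1 : ∀ e : E, adjoint (1 : E →L[ℂ] E) e = e := by
    intro e
    rw [← star_eq_adjoint, star_one]; rfl
  induction n with
  | zero =>
    intro s hs e
    have : s ⊆ {[]} := by
      intro l hl
      have := hs l hl
      simpa using this
    refine (Finset.sum_le_sum_of_subset_of_nonneg this (fun _ _ _ => by positivity)).trans ?_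
    simpa [h1] using hb e
  | succ n ih =>
    intro s hs e
    classical
    have hsub : s ⊆ insert [] ((Finset.univ ×ˢ s.image List.tail).image
        (fun p : Fin N × List (Fin N) => p.1 :: p.2)) := by
      intro l hl
      cases l with
      | nil => simp
      | cons k l =>
        simp only [Finset.mem_insert, Finset.mem_image, Finset.mem_product, Finset.mem_univ]
        exact Or.inr ⟨(k, l), ⟨trivial, _, hl, rfl⟩, rfl⟩
    refine (Finset.sum_le_sum_of_subset_of_nonneg hsub (fun _ _ _ => by positivity)).trans ?_
    rw [Finset.sum_insert (by simp), Finset.sum_image (by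
      rintro ⟨a, b⟩ _ ⟨a', b'⟩ _ hh
      simpa using hh), Finset.sum_product]
    simp only [aux_cons]
    have h2 : ∀ k : Fin N, ∑ l ∈ s.image List.tail,
        ‖adjoint ((l.map Z).prod) (adjoint (Z k) e)‖ ^ 2 ≤ ‖adjoint (Z k) e‖ ^ 2 / c := by
      intro k
      apply ih
      intro l hl
      obtain ⟨l', hl', rfl⟩ := Finset.mem_image.1 hl
      have := hs l' hl'
      simp; omega
    have h3 := Finset.sum_le_sum (fun k (_ : k ∈ Finset.univ) => h2 k)
    rw [← Finset.sum_div] at h3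
    have h4 : (∑ k, ‖adjoint (Z k) e‖ ^ 2) / c ≤ (‖e‖ ^ 2 - c * ‖e‖ ^ 2) / c := by
      gcongr
      linarith [h e]
    rw [sub_div, mul_div_cancel_left₀ _ hc.ne'] at h4
    simp only [List.map_nil, List.prod_nil, h1]
    linarith

lemma aux_mem [Nontrivial E] {N : ℕ} (Z : Fin N → E →L[ℂ] E) (h : inBall Z) (e : E) :
    Memℓp (fun σ : Word N => adjoint (wprod Z σ) e) 2 := by
  obtain ⟨c, hc, hh⟩ := aux_coercive Z h
  refine memℓp_gen' (C := ‖e‖ ^ 2 / c) (fun s => ?_)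
  have := aux_sum Z c hc hh (s.sup (fun l => (FreeMonoid.toList l).length)) s
    (fun l hl => Finset.le_sup (f := fun l : Word N => (FreeMonoid.toList l).length) hl) e
  simp only [ENNReal.toReal_ofNat, Real.rpow_ofNat]
  exact this

lemma aux_ball {N : ℕ} (A : Fin N → E →L[ℂ] E) :
    ∃ r : ℝ, 0 < r ∧ inBall (fun k => r • A k) := by
  set B : E →L[ℂ] E := ∑ k, A k * adjoint (A k) with hB
  have hBp : B.IsPositive := by
    apply isPositive_sum
    intro k _
    exact isPositive_self_comp_adjoint _
  set r : ℝ := 1 / (1 + ‖B‖) with hr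
  have hr0 : 0 < r := by positivity
  have hr1 : r * (1 + ‖B‖) = 1 := by rw [hr]; field_simp
  have hr2 : r ^ 2 * ‖B‖ < 1 := by
    have : r ≤ 1 := by nlinarith [norm_nonneg B]
    nlinarith [norm_nonneg B, mul_nonneg hr0.le (norm_nonneg B)]
  have hsum : ∑ k, (r • A k) * adjoint (r • A k) = r ^ 2 • B := by
    rw [hB, Finset.smul_sum]
    refine Finset.sum_congr rfl fun k _ => ?_
    rw [← star_eq_adjoint, star_smul, star_trivial, smul_mul_smul_comm, ← star_eq_adjoint, sq]
  have hn : ‖r ^ 2 • B‖ < 1 := by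
    rw [norm_smul, Real.norm_of_nonneg (by positivity)]; exact hr2
  refine ⟨r, hr0, ?_⟩
  unfold inBall
  rw [hsum]
  refine ⟨?_, isUnit_one_sub_of_norm_lt_one hn⟩
  rw [isPositive_def']
  refine ⟨?_, fun x => ?_⟩
  · exact (IsSelfAdjoint.one _).sub ((IsSelfAdjoint.all (r ^ 2)).smul hBp.isSelfAdjoint)
  · have h4 : (⟪x, x⟫_ℂ).re = ‖x‖ ^ 2 := by
      rw [inner_self_eq_norm_sq_to_K]; norm_cast
    rw [reApplyInnerSelf_apply, sub_apply, one_apply_eq_self, inner_sub_left, map_sub,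
      RCLike.re_to_complex, RCLike.re_to_complex, h4]
    have h5 : (⟪(r ^ 2 • B) x, x⟫_ℂ).re ≤ ‖x‖ ^ 2 := by
      refine (Complex.re_le_norm _).trans ((norm_inner_le_norm _ _).trans ?_)
      have := (r ^ 2 • B).le_opNorm x
      nlinarith [norm_nonneg x, sq_nonneg ‖x‖]
    linarith

lemma aux_orth (hE : ¬ FiniteDimensional ℂ E) (N : ℕ) (v : E) (hv : ‖v‖ = 1) :
    ∃ e : List (Fin N) → E, Orthonormal ℂ e ∧ e [] = v := by
  classical
  have hs : Orthonormal ℂ ((↑) : ({v} : Set E) → E) := by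
    rw [orthonormal_subtype_iff_ite]
    rintro a rfl b rfl
    simp [inner_self_eq_norm_sq_to_K, hv]
  obtain ⟨w, b, hvw, hb⟩ := hs.exists_hilbertBasis_extension
  have hw : w.Infinite := by
    intro hfin
    have := hfin.fintype
    exact hE (Module.Finite.of_basis b.toOrthonormalBasis.toBasis)
  have hw' : (w \ {v}).Infinite := hw.sdiff (Set.finite_singleton v)
  let g := hw'.natEmbedding
  have hvw' : v ∈ w := hvw rfl
  let i : List (Fin N) → w := fun l => if l = [] then ⟨v, hvw'⟩ else
    ⟨g (Encodable.encode l), (g (Encodable.encode l)).2.1⟩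
  have hi : Function.Injective i := by
    intro a c hac
    have hne : ∀ n, (g n : E) ≠ v := fun n => (g n).2.2
    by_cases ha : a = [] <;> by_cases hc : c = []
    · rw [ha, hc]
    · simp only [i, ha, hc, if_true, if_false, Subtype.mk.injEq] at hac
      exact absurd hac.symm (hne _)
    · simp only [i, ha, hc, if_true, if_false, Subtype.mk.injEq] at hac
      exact absurd hac (hne _)
    · simp only [i, ha, hc, if_false, Subtype.mk.injEq] at hac
      exact Encodable.encode_injective (g.injective (Subtype.ext hac))
  refine ⟨fun l => b (i l), b.orthonormal.comp i hi, ?_⟩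
  simp [hb, i]

open Classical in
lemma aux_shift {N : ℕ} (e : List (Fin N) → E) (he : Orthonormal ℂ e) (r : ℝ)
    (S : Finset (List (Fin N))) (hS : ∀ k l, k :: l ∈ S → l ∈ S) (Z : Fin N → E →L[ℂ] E)
    (hZ : ∀ k x, adjoint (Z k) x = r • ∑ ρ ∈ S, ⟪e (k :: ρ), x⟫_ℂ • e ρ)
    (σ : List (Fin N)) : ∀ μ ∈ S, adjoint ((σ.map Z).prod) (e μ) =
      if σ <+: μ then r ^ σ.length • e (μ.drop σ.length) else 0 := by
  have h1 : ∀ e : E, adjoint (1 : E →L[ℂ] E) e = e := by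
    intro e
    rw [← star_eq_adjoint, star_one]; rfl
  induction σ with
  | nil => intro μ _; simp [h1]
  | cons k σ ih =>
    intro μ hμ
    rw [aux_cons, hZ]
    simp only [orthonormal_iff_ite.1 he]
    cases μ with
    | nil => simp
    | cons k' ρ =>
      have hρ := hS _ _ hμ
      by_cases hk : k = k'
      · subst hk
        simp only [List.cons.injEq, true_and, ite_smul, one_smul, zero_smul,
          Finset.sum_ite_eq', hρ, if_true, List.cons_prefix_cons, List.length_cons,
          List.drop_succ_cons]
        have : adjoint ((σ.map Z).prod) (r • e ρ) = r • adjoint ((σ.map Z).prod) (e ρ) := by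
          exact (adjoint ((σ.map Z).prod)).map_smul_of_tower r (e ρ)
        rw [this, ih ρ hρ, smul_ite, smul_zero, smul_smul, pow_succ']
      · simp [hk]

open Classical in
lemma aux_span (hE : ¬ FiniteDimensional ℂ E) {N : ℕ}
    (V : Submodule ℂ (lp (fun _ : Word N => E) 2))
    (hV : ∀ (f : lp (fun _ : Word N => E) 2) (Z : Fin N → E →L[ℂ] E), inBall Z → ∀ e : E,
      (∀ σ : Word N, (f : ∀ _ : Word N, E) σ = adjoint (wprod Z σ) e) → f ∈ V) (n : ℕ) :
    ∀ τ : Word N, (FreeMonoid.toList τ).length = n → ∀ x : E,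
      lp.single (E := fun _ : Word N => E) 2 τ x ∈ V := by
  induction n using Nat.strong_induction_on with
  | _ n ih =>
  intro τ hτ x
  by_cases hx : x = 0
  · rw [hx, lp.single_zero]; exact V.zero_mem
  have : Nontrivial E := ⟨x, 0, hx⟩
  have hxn : ‖x‖ ≠ 0 := norm_ne_zero_iff.2 hx
  obtain ⟨e, he, hev⟩ := aux_orth hE N ((‖x‖⁻¹ : ℝ) • x) (by
    rw [norm_smul, norm_inv, norm_norm, inv_mul_cancel₀ hxn])
  let S : Finset (List (Fin N)) := (FreeMonoid.toList τ).tails.toFinset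
  have hS : ∀ k l, k :: l ∈ S → l ∈ S := by
    intro k l h
    simp only [S, List.mem_toFinset, List.mem_tails] at h ⊢
    exact (List.suffix_cons k l).trans h
  obtain ⟨r, hr, hball⟩ := aux_ball (fun k : Fin N =>
    adjoint (∑ ρ ∈ S, InnerProductSpace.rankOne ℂ (e ρ) (e (k :: ρ))))
  set Z : Fin N → E →L[ℂ] E := fun k : Fin N =>
    r • adjoint (∑ ρ ∈ S, InnerProductSpace.rankOne ℂ (e ρ) (e (k :: ρ))) with hZdef
  have hZ : ∀ k x, adjoint (Z k) x = r • ∑ ρ ∈ S, ⟪e (k :: ρ), x⟫_ℂ • e ρ := by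
    intro k x
    have : adjoint (Z k) = r • ∑ ρ ∈ S, InnerProductSpace.rankOne ℂ (e ρ) (e (k :: ρ)) := by
      rw [hZdef, ← star_eq_adjoint, star_smul, star_trivial, star_eq_adjoint, adjoint_adjoint]
    rw [this, smul_apply, sum_apply]
    simp
  have key := fun σ => aux_shift e he r S hS Z hZ σ (FreeMonoid.toList τ) (by simp [S])
  let f : lp (fun _ : Word N => E) 2 := ⟨_, aux_mem Z hball (e (FreeMonoid.toList τ))⟩
  have hf : f ∈ V := hV f Z hball _ (fun σ => rfl)
  have hfσ : ∀ σ : Word N, (f : ∀ _ : Word N, E) σ =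
      if FreeMonoid.toList σ <+: FreeMonoid.toList τ then r ^ (FreeMonoid.toList σ).length •
        e ((FreeMonoid.toList τ).drop (FreeMonoid.toList σ).length) else 0 := fun σ => key _
  let P : Finset (Word N) := ((FreeMonoid.toList τ).inits.map FreeMonoid.ofList).toFinset
  have hP : ∀ σ : Word N, σ ∈ P ↔ FreeMonoid.toList σ <+: FreeMonoid.toList τ := by
    intro σ
    simp only [P, List.mem_toFinset, List.mem_map, List.mem_inits]
    constructor
    · rintro ⟨a, ha, rfl⟩
      exact ha
    · intro h
      exact ⟨_, h, rfl⟩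
  have hfs : f = ∑ σ ∈ P, lp.single (E := fun _ : Word N => E) 2 σ
      ((f : ∀ _ : Word N, E) σ) := by
    apply lp.ext
    funext σ
    rw [lp.coeFn_sum, Finset.sum_apply]
    simp only [lp.single_apply]
    rw [Finset.sum_pi_single]
    split_ifs with h
    · rfl
    · rw [hfσ, if_neg (fun h' => h ((hP σ).2 h'))]
  have hτP : τ ∈ P := (hP τ).2 (List.prefix_refl _)
  rw [← Finset.add_sum_erase _ _ hτP] at hfs
  have hrest : ∑ σ ∈ P.erase τ, lp.single (E := fun _ : Word N => E) 2 σ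
      ((f : ∀ _ : Word N, E) σ) ∈ V := by
    refine V.sum_mem fun σ hσ => ?_
    obtain ⟨hne, hσP⟩ := Finset.mem_erase.1 hσ
    have hpre := (hP σ).1 hσP
    refine ih (FreeMonoid.toList σ).length ?_ σ rfl _
    rw [← hτ]
    refine lt_of_le_of_ne hpre.length_le fun hl => hne ?_
    exact FreeMonoid.toList.injective (hpre.eq_of_length hl)
  have h1 : lp.single (E := fun _ : Word N => E) 2 τ ((f : ∀ _ : Word N, E) τ) ∈ V := by
    rw [eq_sub_of_add_eq hfs.symm]
    exact V.sub_mem hf hrest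
  rw [hfσ, if_pos (List.prefix_refl _), List.drop_length, hev, smul_smul] at h1
  set t : ℝ := r ^ (FreeMonoid.toList τ).length * ‖x‖⁻¹ with ht
  have ht0 : t ≠ 0 := mul_ne_zero (pow_ne_zero _ hr.ne') (inv_ne_zero hxn)
  have h2 := V.smul_mem ((t⁻¹ : ℝ) : ℂ) h1
  rw [← lp.single_smul] at h2
  have h3 : ((t⁻¹ : ℝ) : ℂ) • t • x = x := by
    rw [Complex.coe_smul, smul_smul, inv_mul_cancel₀ ht0, one_smul]
  rwa [h3] at h2

/-- Lemma 4.1(b): for an infinite-dimensional Hilbert space `E`, the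
families `((Z_σ)^* e)_{σ ∈ F_N^+}` with `Z ∈ B_N(E)`, `e ∈ E` are square-summable, and
their linear span is dense in `ℓ²(F_N^+; E)`. -/
theorem stmt6 {E : Type*} [NormedAddCommGroup E] [InnerProductSpace ℂ E] [CompleteSpace E]
    (hE : ¬ FiniteDimensional ℂ E) {N : ℕ} (hN : 1 ≤ N) :
    (∀ Z : Fin N → E →L[ℂ] E, inBall Z → ∀ e : E,
      Memℓp (fun σ : Word N => adjoint (wprod Z σ) e) 2) ∧
    Dense ((Submodule.span ℂ {f : lp (fun _ : Word N => E) 2 |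
        ∃ Z : Fin N → E →L[ℂ] E, inBall Z ∧ ∃ e : E, ∀ σ : Word N,
          (f : ∀ _ : Word N, E) σ = adjoint (wprod Z σ) e} :
        Submodule ℂ (lp (fun _ : Word N => E) 2)) :
      Set (lp (fun _ : Word N => E) 2)) := by
  classical
  have : Nontrivial E := by
    by_contra h
    rw [not_nontrivial_iff_subsingleton] at h
    exact hE inferInstance
  refine ⟨fun Z hZ e => aux_mem Z hZ e, ?_⟩
  intro f
  have : Fact (1 ≤ (2 : ENNReal)) := ⟨by norm_num⟩
  have hs := lp.hasSum_single (E := fun _ : Word N => E) (p := 2) (by norm_num) f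
  refine mem_closure_of_tendsto hs (Filter.Eventually.of_forall fun s => ?_)
  refine Submodule.sum_mem _ fun σ _ => ?_
  refine aux_span hE _ (fun g Z hZ e hg => ?_) _ σ rfl _
  exact Submodule.subset_span ⟨Z, hZ, e, hg⟩
end
end

section
/- Let E be a complex Hilbert space, N ≥ 1, T ∈ L(E), and Z, Z' ∈ B_N(E). Put D = T − Σ_{k=1}^N Z_k·T·(Z'_k)^*. Then for all e, f ∈ E the family (⟨D·(Z'_σ)^* f, (Z_σ)^* e⟩)_{σ∈F_N^+} is summable with sum ⟨T f, e⟩; that is, Σ_{σ∈F_N^+} Z_σ·(T − Σ_{k=1}^N Z_k T (Z'_k)^*)·(Z'_σ)^* = T, the sum converging in the weak operator topology. -/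
noncomputable section
open scoped InnerProductSpace ComplexConjugate
open ContinuousLinearMap

variable {E : Type*} [NormedAddCommGroup E] [InnerProductSpace ℂ E] [CompleteSpace E]

lemma inBall_contract {N : ℕ} {Z : Fin N → E →L[ℂ] E} (hZ : inBall Z) :
    ∃ r : ℝ, 0 ≤ r ∧ r < 1 ∧ ∀ x, ∑ k, ‖adjoint (Z k) x‖ ^ 2 ≤ r * ‖x‖ ^ 2 := by
  obtain ⟨hpos, u, hu⟩ := hZ
  have h0 : (0 : E →L[ℂ] E) ≤ 1 - ∑ k, Z k * adjoint (Z k) :=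
    (ContinuousLinearMap.nonneg_iff_isPositive _).2 hpos
  obtain ⟨b, hb⟩ := CStarAlgebra.nonneg_iff_eq_star_mul_self.1 h0
  set M : E →L[ℂ] E := (↑u⁻¹ : E →L[ℂ] E) * star b with hM
  have hMb : M * b = 1 := by
    rw [hM, mul_assoc, ← hb, ← hu, Units.inv_mul]
  set C : ℝ := ‖M‖ + 1 with hC
  have hC1 : 1 ≤ C := by have := norm_nonneg M; linarith
  have hCi : (C ^ 2)⁻¹ ≤ 1 := inv_le_one_of_one_le₀ (one_le_pow₀ hC1)
  have hCp : 0 < (C ^ 2)⁻¹ := by positivity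
  refine ⟨1 - (C ^ 2)⁻¹, by linarith, by linarith, fun x => ?_⟩
  have h1 : ‖x‖ ≤ C * ‖b x‖ := by
    calc ‖x‖ = ‖M (b x)‖ := by
          rw [← ContinuousLinearMap.mul_apply, hMb]; simp
      _ ≤ ‖M‖ * ‖b x‖ := M.le_opNorm _
      _ ≤ C * ‖b x‖ := by gcongr; linarith
  have h2 : (C ^ 2)⁻¹ * ‖x‖ ^ 2 ≤ ‖b x‖ ^ 2 := by
    rw [inv_mul_le_iff₀ (by positivity), ← mul_pow]
    gcongr
  have h3 : ‖b x‖ ^ 2 = ‖x‖ ^ 2 - ∑ k, ‖adjoint (Z k) x‖ ^ 2 := by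
    have h4 : ⟪x, (star b * b) x⟫_ℂ = ⟪x, (1 - ∑ k, Z k * adjoint (Z k)) x⟫_ℂ := by rw [hb]
    simp only [ContinuousLinearMap.mul_apply, ContinuousLinearMap.star_eq_adjoint,
      ContinuousLinearMap.adjoint_inner_right, ContinuousLinearMap.sub_apply,
      ContinuousLinearMap.sum_apply, ContinuousLinearMap.one_apply, inner_sub_right, inner_sum] at h4
    simp only [← ContinuousLinearMap.adjoint_inner_left, inner_self_eq_norm_sq_to_K] at h4
    exact_mod_cast h4
  linarith

/-- The word attached to a tuple of letters. -/
def tw {N n : ℕ} (v : Fin n → Fin N) : Word N := FreeMonoid.ofList (List.ofFn v)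

lemma sum_snoc {N n : ℕ} {M : Type*} [AddCommMonoid M] (g : (Fin (n + 1) → Fin N) → M) :
    ∑ v, g v = ∑ v : Fin n → Fin N, ∑ k, g (Fin.snoc (α := fun _ => Fin N) v k) := by
  rw [← Equiv.sum_comp (Fin.snocEquiv (fun _ => Fin N)), Fintype.sum_prod_type_right]
  rfl

lemma adj_snoc {N n : ℕ} (Z : Fin N → E →L[ℂ] E) (v : Fin n → Fin N) (k : Fin N) (x : E) :
    adjoint (wprod Z (tw (Fin.snoc (α := fun _ => Fin N) v k))) x =
      adjoint (Z k) (adjoint (wprod Z (tw v)) x) := by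
  have : wprod Z (tw (Fin.snoc (α := fun _ => Fin N) v k)) = wprod Z (tw v) * Z k := by
    simp [wprod, tw, List.ofFn_succ', -List.ofFn_succ]
  rw [this, ← ContinuousLinearMap.star_eq_adjoint, star_mul]
  rfl

lemma level_bound {N : ℕ} {Z : Fin N → E →L[ℂ] E} {r : ℝ} (hr : 0 ≤ r)
    (h : ∀ x, ∑ k, ‖adjoint (Z k) x‖ ^ 2 ≤ r * ‖x‖ ^ 2) (e : E) (n : ℕ) :
    ∑ v : Fin n → Fin N, ‖adjoint (wprod Z (tw v)) e‖ ^ 2 ≤ r ^ n * ‖e‖ ^ 2 := by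
  induction n with
  | zero => simp [wprod, tw, ← ContinuousLinearMap.star_eq_adjoint]
  | succ n ih =>
    rw [sum_snoc]
    simp only [adj_snoc]
    calc _ ≤ ∑ v : Fin n → Fin N, r * ‖adjoint (wprod Z (tw v)) e‖ ^ 2 :=
          Finset.sum_le_sum fun v _ => h _
      _ = r * ∑ v : Fin n → Fin N, ‖adjoint (wprod Z (tw v)) e‖ ^ 2 := by rw [Finset.mul_sum]
      _ ≤ r * (r ^ n * ‖e‖ ^ 2) := by gcongr
      _ = _ := by ring

lemma sq_summable {N : ℕ} {Z : Fin N → E →L[ℂ] E} {r : ℝ} (hr : 0 ≤ r) (hr1 : r < 1)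
    (h : ∀ x, ∑ k, ‖adjoint (Z k) x‖ ^ 2 ≤ r * ‖x‖ ^ 2) (e : E) :
    Summable fun p : Σ n, Fin n → Fin N => ‖adjoint (wprod Z (tw p.2)) e‖ ^ 2 := by
  rw [summable_sigma_of_nonneg (fun _ => by positivity)]
  refine ⟨fun n => (hasSum_fintype _).summable, ?_⟩
  refine Summable.of_nonneg_of_le (fun n => tsum_nonneg fun _ => by positivity) (fun n => ?_)
    ((summable_geometric_of_lt_one hr hr1).mul_right (‖e‖ ^ 2))
  rw [tsum_fintype]
  exact level_bound hr h e n

lemma inner_bound (T : E →L[ℂ] E) (a b : E) :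
    ‖⟪a, T b⟫_ℂ‖ ≤ ‖T‖ * (‖a‖ ^ 2 + ‖b‖ ^ 2) := by
  calc ‖⟪a, T b⟫_ℂ‖ ≤ ‖a‖ * ‖T b‖ := norm_inner_le_norm _ _
    _ ≤ ‖a‖ * (‖T‖ * ‖b‖) := by gcongr; exact T.le_opNorm _
    _ = ‖T‖ * (‖a‖ * ‖b‖) := by ring
    _ ≤ _ := by
      gcongr
      nlinarith [sq_nonneg (‖a‖ - ‖b‖), sq_nonneg ‖a‖, sq_nonneg ‖b‖]

/-- Lemma 4.1(c): for `T ∈ L(E)` and `Z, Z' ∈ B_N(E)`, with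
`D = T − Σ_k Z_k T (Z'_k)^*`, one has `Σ_σ Z_σ D (Z'_σ)^* = T` in the weak operator
topology; i.e. for all `e, f ∈ E` the family `(⟨D (Z'_σ)^* f, (Z_σ)^* e⟩)_σ` sums to
`⟨T f, e⟩`. Here `⟨u, v⟩` (linear in `u`) is written as `⟪v, u⟫_ℂ` in Mathlib's
convention. -/
theorem stmt7 {E : Type*} [NormedAddCommGroup E] [InnerProductSpace ℂ E] [CompleteSpace E]
    {N : ℕ} (hN : 1 ≤ N) (T : E →L[ℂ] E) (Z Z' : Fin N → E →L[ℂ] E)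
    (hZ : inBall Z) (hZ' : inBall Z') (e f : E) :
    HasSum
      (fun σ : Word N =>
        ⟪(adjoint (wprod Z σ)) e,
          (T - ∑ k, Z k * T * adjoint (Z' k)) ((adjoint (wprod Z' σ)) f)⟫_ℂ)
      ⟪e, T f⟫_ℂ := by
  obtain ⟨r, hr, hr1, hc⟩ := inBall_contract hZ
  obtain ⟨r', hr', hr1', hc'⟩ := inBall_contract hZ'
  set D := T - ∑ k, Z k * T * adjoint (Z' k) with hD
  let F : (Σ n, Fin n → Fin N) → ℂ := fun p =>
    ⟪adjoint (wprod Z (tw p.2)) e, D (adjoint (wprod Z' (tw p.2)) f)⟫_ℂ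
  let S : ℕ → ℂ := fun n => ∑ v : Fin n → Fin N,
    ⟪adjoint (wprod Z (tw v)) e, T (adjoint (wprod Z' (tw v)) f)⟫_ℂ
  have hFs : Summable F := by
    refine Summable.of_norm_bounded
      (((sq_summable hr hr1 hc e).add (sq_summable hr' hr1' hc' f)).mul_left ‖D‖) fun p => ?_
    exact inner_bound D _ _
  have hS0 : S 0 = ⟪e, T f⟫_ℂ := by
    simp [S, wprod, tw, ← ContinuousLinearMap.star_eq_adjoint]
  have hSlim : Filter.Tendsto S Filter.atTop (nhds 0) := by
    have hg : Filter.Tendsto (fun n : ℕ => ‖T‖ * (r ^ n * ‖e‖ ^ 2 + r' ^ n * ‖f‖ ^ 2))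
        Filter.atTop (nhds 0) := by
      have := ((((tendsto_pow_atTop_nhds_zero_of_lt_one hr hr1).mul_const (‖e‖ ^ 2)).add
        ((tendsto_pow_atTop_nhds_zero_of_lt_one hr' hr1').mul_const (‖f‖ ^ 2))).const_mul ‖T‖)
      simpa using this
    refine squeeze_zero_norm (fun n => ?_) hg
    calc ‖S n‖ ≤ ∑ v : Fin n → Fin N, ‖T‖ * (‖adjoint (wprod Z (tw v)) e‖ ^ 2 +
            ‖adjoint (wprod Z' (tw v)) f‖ ^ 2) :=
          norm_sum_le_of_le _ fun v _ => inner_bound T _ _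
      _ = ‖T‖ * (∑ v : Fin n → Fin N, ‖adjoint (wprod Z (tw v)) e‖ ^ 2 +
            ∑ v : Fin n → Fin N, ‖adjoint (wprod Z' (tw v)) f‖ ^ 2) := by
          rw [← Finset.mul_sum, Finset.sum_add_distrib]
      _ ≤ _ := by
          gcongr
          · exact level_bound hr hc e n
          · exact level_bound hr' hc' f n
  have hlev : ∀ n, ∑ v : Fin n → Fin N, F ⟨n, v⟩ = S n - S (n + 1) := by
    intro n
    simp only [S, F]
    rw [sum_snoc, ← Finset.sum_sub_distrib]
    refine Finset.sum_congr rfl fun v _ => ?_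
    simp only [adj_snoc, hD, ContinuousLinearMap.sub_apply, ContinuousLinearMap.sum_apply,
      ContinuousLinearMap.mul_apply, inner_sub_right, inner_sum,
      ContinuousLinearMap.adjoint_inner_left]
  have h1 : HasSum (fun n => S n - S (n + 1)) (∑' p, F p) := by
    refine hFs.hasSum.sigma fun n => ?_
    rw [← hlev n]
    exact hasSum_fintype _
  have h2 := h1.tendsto_sum_nat
  have h3 : Filter.Tendsto (fun n => ∑ i ∈ Finset.range n, (S i - S (i + 1)))
      Filter.atTop (nhds (S 0 - 0)) := by
    simp only [Finset.sum_range_sub']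
    exact tendsto_const_nhds.sub hSlim
  have h4 : ∑' p, F p = ⟪e, T f⟫_ℂ := by
    rw [tendsto_nhds_unique h2 h3, sub_zero, hS0]
  have h5 : HasSum F ⟪e, T f⟫_ℂ := h4 ▸ hFs.hasSum
  let φ : (Σ n, Fin n → Fin N) ≃ Word N :=
    (List.equivSigmaTuple (α := Fin N)).symm.trans FreeMonoid.ofList
  rw [← φ.hasSum_iff]
  exact h5
end
end

section
/- Let E be an infinite-dimensional complex Hilbert space, N ≥ 1, and let σ ∈ F_N^+ be a nonempty word with k = |σ|. Then there exist Z^1, …, Z^{2k} ∈ B_N(E) such that: (i) Z^l_τ = 0 for every l ∈ {1,…,2k} and every word τ ≠ σ with |τ| ≥ k; (ii) the linear map E^{2k} → E sending (e_1,…,e_{2k}) to Σ_{l=1}^{2k} (Z^l_σ)^* e_l is surjective. -/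
noncomputable section
open scoped InnerProductSpace ComplexConjugate
open ContinuousLinearMap

variable {E : Type*} [NormedAddCommGroup E] [InnerProductSpace ℂ E] [CompleteSpace E]

/-- isometry induced by an injection of the index set of a Hilbert basis -/
theorem exists_shift {E : Type*} [NormedAddCommGroup E] [InnerProductSpace ℂ E] [CompleteSpace E]
    {ι : Type*} (b : HilbertBasis ι ℂ E) (f : ι → ι) (hf : Function.Injective f) :
    ∃ S : E →L[ℂ] E, ∀ i, S (b i) = b (f i) := by
  classical
  have ho : Orthonormal ℂ (fun i => b (f i)) := b.orthonormal.comp f hf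
  refine ⟨(ho.orthogonalFamily.linearIsometry.toContinuousLinearMap).comp
    (b.repr.toContinuousLinearEquiv : E →L[ℂ] _), fun i => ?_⟩
  simp [HilbertBasis.repr_self, OrthogonalFamily.linearIsometry_apply_single]

theorem ext_basis {E : Type*} [NormedAddCommGroup E] [InnerProductSpace ℂ E] [CompleteSpace E]
    {ι : Type*} (b : HilbertBasis ι ℂ E) (S T : E →L[ℂ] E) (h : ∀ i, S (b i) = T (b i)) :
    S = T := by
  refine ContinuousLinearMap.ext_on (s := Set.range b) ?_ ?_
  · exact Submodule.dense_iff_topologicalClosure_eq_top.2 b.dense_span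
  · rintro _ ⟨i, rfl⟩
    exact h i

theorem shift_adj {E : Type*} [NormedAddCommGroup E] [InnerProductSpace ℂ E] [CompleteSpace E]
    {ι : Type*} (b : HilbertBasis ι ℂ E) (f : ι → ι) (S : E →L[ℂ] E)
    (hS : ∀ i, S (b i) = b (f i)) (x : E) (i : ι) :
    b.repr (adjoint S x) i = inner ℂ (b (f i)) x := by
  rw [HilbertBasis.repr_apply_apply, adjoint_inner_right, hS]

theorem exists_cuntz {E : Type*} [NormedAddCommGroup E] [InnerProductSpace ℂ E] [CompleteSpace E]
    (hE : ¬ FiniteDimensional ℂ E) :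
    ∃ S T : E →L[ℂ] E, adjoint S * S = 1 ∧ adjoint T * T = 1 ∧ adjoint S * T = 0 ∧
      adjoint T * S = 0 ∧ S * adjoint S + T * adjoint T = 1 := by
  classical
  obtain ⟨w, b, hb⟩ := exists_hilbertBasis ℂ E
  have hinf : Infinite w := by
    by_contra hfin
    rw [not_infinite_iff_finite] at hfin
    have := Fintype.ofFinite w
    exact hE (b.toOrthonormalBasis.toBasis.finiteDimensional_of_finite)
  have hcard : Nonempty ((w ⊕ w) ≃ w) := by
    rw [← Cardinal.eq]
    simp [Cardinal.add_eq_self (Cardinal.aleph0_le_mk w)]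
  obtain ⟨e⟩ := hcard
  obtain ⟨S, hS⟩ := exists_shift b (fun i => e (Sum.inl i)) (e.injective.comp Sum.inl_injective)
  obtain ⟨T, hT⟩ := exists_shift b (fun i => e (Sum.inr i)) (e.injective.comp Sum.inr_injective)
  have hi := orthonormal_iff_ite.1 b.orthonormal
  have key1 : adjoint S * S = 1 := by
    refine ext_basis b _ _ fun i => b.repr.injective (lp.ext (funext fun j => ?_))
    rw [mul_apply_eq_comp, hS, shift_adj b _ S hS, hi, HilbertBasis.repr_apply_apply,
      ContinuousLinearMap.one_apply, hi]
    simp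
  have key2 : adjoint T * T = 1 := by
    refine ext_basis b _ _ fun i => b.repr.injective (lp.ext (funext fun j => ?_))
    rw [mul_apply_eq_comp, hT, shift_adj b _ T hT, hi, HilbertBasis.repr_apply_apply,
      ContinuousLinearMap.one_apply, hi]
    simp
  have key3 : adjoint S * T = 0 := by
    refine ext_basis b _ _ fun i => b.repr.injective (lp.ext (funext fun j => ?_))
    simp only [mul_apply_eq_comp, hT, shift_adj b _ S hS, hi]
    simp
  have key4 : adjoint T * S = 0 := by
    refine ext_basis b _ _ fun i => b.repr.injective (lp.ext (funext fun j => ?_))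
    simp only [mul_apply_eq_comp, hS, shift_adj b _ T hT, hi]
    simp
  refine ⟨S, T, key1, key2, key3, key4, ext_basis b _ _ fun i => ?_⟩
  have k1 := fun x => DFunLike.congr_fun key1 x
  have k2 := fun x => DFunLike.congr_fun key2 x
  have k3 := fun x => DFunLike.congr_fun key3 x
  have k4 := fun x => DFunLike.congr_fun key4 x
  simp only [mul_apply_eq_comp, ContinuousLinearMap.one_apply, zero_apply] at k1 k2 k3 k4
  obtain ⟨j, rfl⟩ := e.surjective i
  rcases j with j | j
  · rw [← hS j]
    simp [k1, k4]
  · rw [← hT j]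
    simp [k2, k3]

theorem shift_orth {E : Type*} [NormedAddCommGroup E] [InnerProductSpace ℂ E] [CompleteSpace E]
    (S T : E →L[ℂ] E) (h1 : adjoint S * S = 1) (h2 : adjoint T * T = 1) (h3 : adjoint S * T = 0)
    (h4 : adjoint T * S = 0) (m n : ℕ) :
    adjoint (T ^ m * S) * (T ^ n * S) = if m = n then 1 else 0 := by
  simp only [← star_eq_adjoint] at *
  induction m generalizing n with
  | zero =>
    cases n with
    | zero => simpa using h1
    | succ n =>
      rw [if_neg (by omega), pow_zero, one_mul, pow_succ', mul_assoc, ← mul_assoc, h3, zero_mul]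
  | succ m ih =>
    cases n with
    | zero =>
      rw [if_neg (by omega), pow_zero, one_mul, pow_succ', mul_assoc, star_mul, mul_assoc, h4,
        mul_zero]
    | succ n =>
      have := ih n
      rw [pow_succ', pow_succ', mul_assoc, mul_assoc, star_mul, mul_assoc, ← mul_assoc (star T),
        h2, one_mul, this]
      simp

theorem exists_scale {E : Type*} [NormedAddCommGroup E] [InnerProductSpace ℂ E] [CompleteSpace E]
    {N : ℕ} (W : Fin N → E →L[ℂ] E) :
    ∃ c : ℝ, c ≠ 0 ∧ inBall (fun i => (c : ℂ) • W i) := by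
  set P : E →L[ℂ] E := ∑ k, W k * adjoint (W k) with hP
  have hPsa : IsSelfAdjoint P := by
    rw [hP]
    refine isSelfAdjoint_sum _ fun i _ => ?_
    rw [← star_eq_adjoint]
    exact IsSelfAdjoint.mul_star_self _
  have hpos : 0 < 1 + ‖P‖ := by positivity
  refine ⟨(1 + ‖P‖)⁻¹, by positivity, ?_⟩
  set c : ℝ := (1 + ‖P‖)⁻¹ with hc
  have hc0 : 0 < c := by positivity
  have hc1 : c ≤ 1 := inv_le_one_of_one_le₀ (by linarith [norm_nonneg P])
  have hsum : ∑ k, ((c : ℂ) • W k) * adjoint ((c : ℂ) • W k) = ((c ^ 2 : ℝ) : ℂ) • P := by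
    rw [hP, Finset.smul_sum]
    refine Finset.sum_congr rfl fun i _ => ?_
    rw [← star_eq_adjoint, ← star_eq_adjoint, star_smul, smul_mul_smul_comm]
    congr 1
    simp [pow_two]
  have hnorm : ‖((c ^ 2 : ℝ) : ℂ) • P‖ < 1 := by
    rw [norm_smul, Complex.norm_real, Real.norm_of_nonneg (by positivity)]
    have h1 : c * (1 + ‖P‖) = 1 := inv_mul_cancel₀ hpos.ne'
    have h2 := norm_nonneg P
    nlinarith [mul_nonneg hc0.le h2]
  unfold inBall
  simp only [hsum]
  refine ⟨?_, isUnit_one_sub_of_norm_lt_one hnorm⟩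
  have hsa : IsSelfAdjoint (((c ^ 2 : ℝ) : ℂ) • P) := by
    refine IsSelfAdjoint.smul ?_ hPsa
    simp [isSelfAdjoint_iff]
  rw [isPositive_def']
  refine ⟨(IsSelfAdjoint.one _).sub hsa, fun x => ?_⟩
  set Q := ((c ^ 2 : ℝ) : ℂ) • P
  rw [reApplyInnerSelf_apply, sub_apply, ContinuousLinearMap.one_apply, inner_sub_left, map_sub,
    inner_self_eq_norm_sq]
  have h1 : RCLike.re (inner ℂ (Q x) x) ≤ ‖Q x‖ * ‖x‖ := re_inner_le_norm _ _
  have h2 : ‖Q x‖ ≤ 1 * ‖x‖ := Q.le_of_opNorm_le hnorm.le x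
  nlinarith [norm_nonneg x]

theorem list_step {α : Type*} (M t : List α) (i : α) :
    ((i :: t).reverse = M.take (i :: t).length) ↔
      (t.reverse = M.take t.length ∧ M[t.length]? = some i) := by
  rw [List.reverse_cons, List.length_cons, List.take_add_one]
  constructor
  · intro h
    cases hm : M[t.length]? with
    | none =>
      have hl := congrArg List.length h
      simp [hm] at hl
      omega
    | some a =>
      rw [hm] at h
      have := List.append_inj' h (by simp)
      simp at this
      exact ⟨this.1, by rw [this.2]⟩
  · rintro ⟨h1, h2⟩
    rw [h2, ← h1]
    rfl

theorem word_lemma {E : Type*} [NormedAddCommGroup E] [InnerProductSpace ℂ E] [CompleteSpace E]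
    {N : ℕ} (R : ℕ → E →L[ℂ] E) (hR : ∀ m n, adjoint (R m) * R n = if m = n then 1 else 0)
    (σ : List (Fin N)) (hσ : σ ≠ []) :
    ∃ W : Fin N → E →L[ℂ] E,
      (∀ t : List (Fin N), t ≠ σ → σ.length ≤ t.length → (t.map W).prod = 0) ∧
      (σ.map W).prod = R σ.length * adjoint (R 0) := by
  classical
  set L := σ.reverse with hL
  set W : Fin N → E →L[ℂ] E := fun i =>
    ∑ n ∈ Finset.range σ.length, if L[n]? = some i then R (n + 1) * adjoint (R n) else 0 with hW
  set Q : E →L[ℂ] E := ∑ n ∈ Finset.range σ.length, R n * adjoint (R n) with hQ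
  have hWR : ∀ i n, W i * R n = if L[n]? = some i then R (n + 1) else 0 := by
    intro i n
    rw [hW]
    simp only [Finset.sum_mul, ite_mul, zero_mul, mul_assoc, hR]
    by_cases hn : n < σ.length
    · rw [Finset.sum_eq_single n]
      · simp
      · intro m _ hm
        simp [hm]
      · intro h
        exact absurd (Finset.mem_range.2 hn) h
    · have : L[n]? = none := by simp [hL]; omega
      rw [this, if_neg (by simp)]
      refine Finset.sum_eq_zero fun m hm => ?_
      have : m ≠ n := by
        rintro rfl
        exact hn (Finset.mem_range.1 hm)
      simp [this]
  have hWQ : ∀ i, W i * Q = W i := by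
    intro i
    rw [hQ, Finset.mul_sum]
    simp only [← mul_assoc, hWR]
    rw [hW]
    refine Finset.sum_congr rfl fun n _ => ?_
    split_ifs <;> simp
  have hTR : ∀ (t : List (Fin N)) n, (t.map W).prod * R n =
      if t.reverse = (L.drop n).take t.length then R (n + t.length) else 0 := by
    intro t n
    induction t with
    | nil => simp
    | cons i t ih =>
      rw [List.map_cons, List.prod_cons, mul_assoc, ih, mul_ite, mul_zero, hWR]
      simp only [list_step, List.getElem?_drop, ite_and]
      rfl
  have hTQ : ∀ t : List (Fin N), t ≠ [] → (t.map W).prod * Q = (t.map W).prod := by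
    intro t
    induction t with
    | nil => simp
    | cons i t ih =>
      intro _
      by_cases ht : t = []
      · subst ht
        simp [hWQ]
      · rw [List.map_cons, List.prod_cons, mul_assoc, ih ht]
  have hpos : 0 < σ.length := List.length_pos_iff.2 hσ
  have main : ∀ t : List (Fin N), σ.length ≤ t.length →
      (t.map W).prod = if t = σ then R σ.length * adjoint (R 0) else 0 := by
    intro t ht
    have ht0 : t ≠ [] := List.length_pos_iff.1 (by omega)
    rw [← hTQ t ht0, hQ, Finset.mul_sum]
    simp only [← mul_assoc, hTR]
    rw [Finset.sum_eq_single 0]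
    · have : t.reverse = (L.drop 0).take t.length ↔ t = σ := by
        rw [List.drop_zero, List.take_of_length_le (by simpa [hL] using ht), hL,
          List.reverse_inj]
      simp only [this]
      split_ifs with h
      · simp [h]
      · simp
    · intro n hn hn0
      rw [if_neg, zero_mul]
      intro h
      have hl := congrArg List.length h
      simp [hL] at hl
      have := Finset.mem_range.1 hn
      omega
    · intro h
      exact absurd (Finset.mem_range.2 hpos) h
  refine ⟨W, fun t h1 h2 => ?_, ?_⟩
  · rw [main t h2, if_neg h1]
  · rw [main σ le_rfl, if_pos rfl]

theorem prod_smul_list {E : Type*} [NormedAddCommGroup E] [InnerProductSpace ℂ E]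
    {N : ℕ} (W : Fin N → E →L[ℂ] E) (c : ℂ) (t : List (Fin N)) :
    (t.map (fun i => c • W i)).prod = c ^ t.length • (t.map W).prod := by
  induction t with
  | nil => simp
  | cons i t ih =>
    simp only [List.map_cons, List.prod_cons, ih, List.length_cons]
    rw [smul_mul_smul_comm, pow_succ']

theorem half_lemma {E : Type*} [NormedAddCommGroup E] [InnerProductSpace ℂ E] [CompleteSpace E]
    (S T : E →L[ℂ] E) (h1 : adjoint S * S = 1) (h2 : adjoint T * T = 1) (h3 : adjoint S * T = 0)
    (h4 : adjoint T * S = 0) {N : ℕ} (σ : Word N) (hσ : σ ≠ 1) :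
    ∃ Z : Fin N → E →L[ℂ] E, inBall Z ∧
      (∀ τ : Word N, τ ≠ σ → σ.length ≤ τ.length → wprod Z τ = 0) ∧
      ∀ v : E, ∃ g : E, adjoint (wprod Z σ) g = S v := by
  obtain ⟨W, hW1, hW2⟩ := word_lemma (fun n => T ^ n * S) (shift_orth S T h1 h2 h3 h4)
    (FreeMonoid.toList σ) (fun h => hσ (FreeMonoid.toList.injective h))
  obtain ⟨c, hc, hball⟩ := exists_scale W
  refine ⟨_, hball, fun τ hτ hl => ?_, fun v => ?_⟩
  · unfold wprod
    rw [prod_smul_list, hW1 _ (fun h => hτ (FreeMonoid.toList.injective h)) hl, smul_zero]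
  · set k := (FreeMonoid.toList σ).length with hk
    have hck : (c : ℂ) ^ k ≠ 0 := pow_ne_zero _ (by exact_mod_cast hc)
    refine ⟨((c : ℂ) ^ k)⁻¹ • (T ^ k * S) v, ?_⟩
    have ho := shift_orth S T h1 h2 h3 h4 k k
    rw [if_pos rfl] at ho
    unfold wprod
    rw [prod_smul_list, hW2, ← hk]
    have e : adjoint ((c : ℂ) ^ k • ((T ^ k * S) * adjoint (T ^ 0 * S))) =
        (c : ℂ) ^ k • (S * adjoint (T ^ k * S)) := by
      simp only [← star_eq_adjoint]
      rw [star_smul, star_mul (T ^ k * S), star_star]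
      simp
    rw [e, smul_apply, map_smul, smul_smul, mul_inv_cancel₀ hck, one_smul, mul_apply_eq_comp]
    have := DFunLike.congr_fun ho v
    rw [mul_apply_eq_comp, ContinuousLinearMap.one_apply] at this
    rw [this]

/-- key claim in the proof of Lemma 4.1(b): for an infinite-dimensional
Hilbert space `E` and a nonempty word `σ` of length `k`, there are
`Z^1, …, Z^{2k} ∈ B_N(E)` with `Z^l_τ = 0` for all words `τ ≠ σ` with `|τ| ≥ k`, and
such that `(e_1,…,e_{2k}) ↦ Σ_l (Z^l_σ)^* e_l` is onto `E`. -/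
theorem stmt8 {E : Type*} [NormedAddCommGroup E] [InnerProductSpace ℂ E] [CompleteSpace E]
    (hE : ¬ FiniteDimensional ℂ E) {N : ℕ} (hN : 1 ≤ N)
    (σ : Word N) (hσ : σ ≠ 1) :
    ∃ Z : Fin (2 * σ.length) → Fin N → E →L[ℂ] E,
      (∀ l, inBall (Z l)) ∧
      (∀ (l) (τ : Word N), τ ≠ σ → σ.length ≤ τ.length → wprod (Z l) τ = 0) ∧
      (∀ v : E, ∃ g : Fin (2 * σ.length) → E,
        ∑ l, adjoint (wprod (Z l) σ) (g l) = v) := by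
  classical
  obtain ⟨S, T, h1, h2, h3, h4, h5⟩ := exists_cuntz hE
  obtain ⟨A, hA1, hA2, hA3⟩ := half_lemma S T h1 h2 h3 h4 σ hσ
  obtain ⟨B, hB1, hB2, hB3⟩ := half_lemma T S h2 h1 h4 h3 σ hσ
  have hpos : 0 < σ.length :=
    List.length_pos_iff.2 (fun h => hσ (FreeMonoid.toList.injective h))
  let l0 : Fin (2 * σ.length) := ⟨0, by omega⟩
  let l1 : Fin (2 * σ.length) := ⟨1, by omega⟩
  have hne : l1 ≠ l0 := by simp [l0, l1]
  refine ⟨fun l => if l = l0 then A else B, fun l => ?_, fun l τ => ?_, fun v => ?_⟩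
  · by_cases h : l = l0 <;> simp [h, hA1, hB1]
  · by_cases h : l = l0
    · simpa [h] using hA2 τ
    · simpa [h] using hB2 τ
  · obtain ⟨a, ha⟩ := hA3 (adjoint S v)
    obtain ⟨b, hb⟩ := hB3 (adjoint T v)
    refine ⟨fun l => if l = l0 then a else if l = l1 then b else 0, ?_⟩
    rw [Finset.sum_eq_add_of_mem l0 l1 (Finset.mem_univ _) (Finset.mem_univ _) hne.symm]
    · simp only [if_true, if_neg hne, ha, hb]
      exact DFunLike.congr_fun h5 v
    · rintro l _ ⟨hl0, hl1⟩
      simp [hl0, hl1]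
end
end

section
/- Let N ≥ 1, k ≥ 1, and let σ = i_1⋯i_k and τ = j_1⋯j_k be words of length k in the letters {1,…,N}. For s ∈ {1,…,N} set J_s = {l ∈ {1,…,k} : i_{k+1−l} = s} ⊆ ℤ, and define A_τ = ∩_{p=0}^{k−1} (J_{j_{k−p}} − p), where J − p = {l − p : l ∈ J}. Then A_σ = {1}, and A_τ = ∅ whenever τ ≠ σ. -/
noncomputable section

/-- `J_s = {l ∈ {1,…,k} : i_{k+1−l} = s} ⊆ ℤ`, for the word `σ = i_1⋯i_k` given as a
function `Fin k → Fin N` (so `i_j = σ ⟨j−1⟩`, and `i_{k+1−l} = σ (Fin.rev ⟨l−1⟩)`). -/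
def Jset {N k : ℕ} (σ : Fin k → Fin N) (s : Fin N) : Set ℤ :=
  {x : ℤ | ∃ l : Fin k, x = (l : ℤ) + 1 ∧ σ l.rev = s}

/-- `A_τ = ∩_{p=0}^{k−1} (J_{j_{k−p}} − p)` where `τ = j_1⋯j_k`; here
`x ∈ J − p ↔ x + p ∈ J` and `j_{k−p} = τ (Fin.rev p)`. -/
def Aset {N k : ℕ} (σ : Fin k → Fin N) (τ : Fin k → Fin N) : Set ℤ :=
  ⋂ p : Fin k, {x : ℤ | x + (p : ℤ) ∈ Jset σ (τ p.rev)}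

/-- An element of `A_τ` is `1`, and then `τ = σ`. -/
theorem Aset_mem {N k : ℕ} (hk : 1 ≤ k) (σ τ : Fin k → Fin N) (x : ℤ)
    (hx : x ∈ Aset σ τ) : x = 1 ∧ τ = σ := by
  simp only [Aset, Jset, Set.mem_iInter, Set.mem_setOf_eq] at hx
  have hx1 : x = 1 := by
    obtain ⟨l, hl, _⟩ := hx ⟨0, hk⟩
    obtain ⟨m, hm, _⟩ := hx ⟨k - 1, by omega⟩
    have := m.isLt
    simp only at hl hm
    omega
  refine ⟨hx1, funext fun q => ?_⟩
  obtain ⟨l, hl, h⟩ := hx q.rev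
  have : l = q.rev := Fin.ext (by omega)
  subst this
  simpa using h.symm

/-- `A_σ = {1}`, and `A_τ = ∅` whenever `τ ≠ σ` (from the proof of
Lemma 4.1(b)). -/
theorem stmt9 {N k : ℕ} (hN : 1 ≤ N) (hk : 1 ≤ k) (σ : Fin k → Fin N) :
    Aset σ σ = {1} ∧ ∀ τ : Fin k → Fin N, τ ≠ σ → Aset σ τ = ∅ := by
  constructor
  · ext x
    constructor
    · intro hx
      exact (Aset_mem hk σ σ x hx).1
    · rintro rfl
      simp only [Aset, Jset, Set.mem_iInter, Set.mem_setOf_eq]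
      intro p
      exact ⟨p, by ring, rfl⟩
  · intro τ hτ
    refine Set.eq_empty_iff_forall_notMem.2 fun x hx => hτ (Aset_mem hk σ τ x hx).2
end
end

section
/- Let N ≥ 1, k ≥ 1, let σ = i_1⋯i_k be a word of length k in the letters {1,…,N}, and let p ∈ {1,…,k}. For s ∈ {1,…,N} set J_s = {l ∈ {1,…,k} : i_{k+1−l} = s}, and define the 2k×2k complex matrices V_s = (1/√2)·Σ_{r∈J_s} E_{r+p−1, r+p}, where E_{a,b} denotes the matrix unit with 1 in entry (a,b) and 0 elsewhere (indices ranging over {1,…,2k}). Then for every word τ = j_1⋯j_k of length k: V_{j_k}·V_{j_{k−1}}⋯V_{j_1} = (1/√(2^k))·Σ_{r∈A_τ} E_{r+p−1, r+p+k−1}, where A_τ = ∩_{q=0}^{k−1} (J_{j_{k−q}} − q). In particular V_{i_k}⋯V_{i_1} = (1/√(2^k))·E_{p, k+p}, and V_{j_k}⋯V_{j_1} = 0 for every word τ = j_1⋯j_k of length k with τ ≠ σ. -/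
noncomputable section

/-- The matrix unit `E_{a,b} ∈ M_{2k}(ℂ)` with `1` in entry `(a,b)` and `0` elsewhere,
with indices `a, b` ranging over `{1,…,2k}` (1-based). Out of range it is `0`. -/
def Eu (k : ℕ) (a b : ℕ) : Matrix (Fin (2 * k)) (Fin (2 * k)) ℂ :=
  Matrix.of fun i j => if (i : ℕ) + 1 = a ∧ (j : ℕ) + 1 = b then 1 else 0

/-- `J_s = {l ∈ {1,…,k} : i_{k+1−l} = s}`, encoded 0-based: the 1-based element `r`
corresponds to `l = r − 1 : Fin k`, and `i_{k+1−r} = σ (Fin.rev l)`. -/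
def Jfin {N k : ℕ} (σ : Fin k → Fin N) (s : Fin N) : Finset (Fin k) :=
  Finset.univ.filter fun l => σ l.rev = s

/-- `V_s = (1/√2)·Σ_{r ∈ J_s} E_{r+p−1, r+p}`, with `p ∈ {1,…,k}` encoded 0-based as
`p0 = p − 1 : Fin k` (so `r + p − 1 = l + p0 + 1` and `r + p = l + p0 + 2`, 1-based). -/
def Vmat {N k : ℕ} (σ : Fin k → Fin N) (p0 : Fin k) (s : Fin N) :
    Matrix (Fin (2 * k)) (Fin (2 * k)) ℂ :=
  ((Real.sqrt 2 : ℂ))⁻¹ • ∑ l ∈ Jfin σ s, Eu k ((l : ℕ) + (p0 : ℕ) + 1) ((l : ℕ) + (p0 : ℕ) + 2)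

open scoped Classical in
/-- `A_τ = ∩_{q=0}^{k−1} (J_{j_{k−q}} − q)`, encoded 0-based: the 1-based element `r`
corresponds to `r0 = r − 1 : Fin k`, and `r ∈ J − q` means `r + q ∈ J ⊆ {1,…,k}`,
i.e. `r0 + q < k` together with `⟨r0 + q⟩ ∈ Jfin σ (τ (Fin.rev q))`. -/
def Afin {N k : ℕ} (σ τ : Fin k → Fin N) : Finset (Fin k) :=
  Finset.univ.filter fun r0 => ∀ q : Fin k,
    ∃ h : (r0 : ℕ) + (q : ℕ) < k, (⟨(r0 : ℕ) + (q : ℕ), h⟩ : Fin k) ∈ Jfin σ (τ q.rev)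

def PosOk {N k : ℕ} (σ : Fin k → Fin N) (p0 : Fin k) (s : Fin N) (n : ℕ) : Prop :=
  ∃ l : Fin k, σ l.rev = s ∧ n = (l : ℕ) + (p0 : ℕ)

open scoped Classical in
lemma sum_Eu_apply {k : ℕ} (S : Finset (Fin k)) (c d : ℕ) (i j : Fin (2 * k)) :
    (∑ l ∈ S, Eu k ((l : ℕ) + c + 1) ((l : ℕ) + c + d + 1)) i j =
      if (j : ℕ) = i + d ∧ ∃ l ∈ S, (i : ℕ) = (l : ℕ) + c then 1 else 0 := by
  rw [Matrix.sum_apply]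
  simp only [Eu, Matrix.of_apply]
  split_ifs with h
  · obtain ⟨h1, l, hl, h2⟩ := h
    rw [Finset.sum_eq_single_of_mem l hl]
    · rw [if_pos]; omega
    · intro b _ hb
      rw [if_neg]
      intro h
      apply hb
      apply Fin.ext
      omega
  · apply Finset.sum_eq_zero
    intro l hl
    rw [if_neg]
    intro h'
    exact h ⟨by omega, l, hl, by omega⟩

open scoped Classical in
lemma Vmat_apply {N k : ℕ} (σ : Fin k → Fin N) (p0 : Fin k) (s : Fin N) (i j : Fin (2 * k)) :
    Vmat σ p0 s i j = ((Real.sqrt 2 : ℂ))⁻¹ *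
      if (j : ℕ) = i + 1 ∧ PosOk σ p0 s i then 1 else 0 := by
  have := sum_Eu_apply (Jfin σ s) p0 1 i j
  rw [Vmat, Matrix.smul_apply, smul_eq_mul]
  congr 1
  refine this.trans (if_congr ?_ rfl rfl)
  simp [Jfin, PosOk]

open scoped Classical in
lemma word_prod_apply {N k : ℕ} (σ : Fin k → Fin N) (p0 : Fin k) (w : List (Fin N)) :
    ∀ i j : Fin (2 * k), (w.map (Vmat σ p0)).prod i j =
      ((Real.sqrt 2 : ℂ))⁻¹ ^ w.length *
      if (j : ℕ) = i + w.length ∧ ∀ q (h : q < w.length), PosOk σ p0 w[q] (i + q)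
        then 1 else 0 := by
  induction w with
  | nil =>
    intro i j
    simp [Matrix.one_apply, Fin.ext_iff, eq_comm]
  | cons s w ih =>
    intro i j
    rw [List.map_cons, List.prod_cons, Matrix.mul_apply]
    simp only [ih, Vmat_apply, List.length_cons]
    have key : ((j : ℕ) = i + (w.length + 1) ∧ ∀ q (h : q < (s :: w).length),
        PosOk σ p0 (s :: w)[q] (i + q)) ↔ (PosOk σ p0 s i ∧ (j : ℕ) = (i + 1) + w.length ∧
          ∀ q (h : q < w.length), PosOk σ p0 w[q] ((i + 1) + q)) := by
      constructor
      · rintro ⟨h1, h2⟩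
        refine ⟨h2 0 (by simp), by omega, fun q h => ?_⟩
        have := h2 (q + 1) (by simpa using h)
        simpa [add_assoc, add_comm, add_left_comm] using this
      · rintro ⟨h1, h2, h3⟩
        refine ⟨by omega, fun q h => ?_⟩
        cases q with
        | zero => simpa using h1
        | succ q =>
          have := h3 q (by simpa using h)
          simpa [add_assoc, add_comm, add_left_comm] using this
    simp only [List.length_cons] at key
    by_cases hi : (i : ℕ) + 1 < 2 * k
    · rw [Finset.sum_eq_single_of_mem (⟨i + 1, hi⟩ : Fin (2 * k)) (Finset.mem_univ _)]
      · simp only [key, true_and]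
        rw [pow_succ]
        split_ifs <;> first | ring1 | (exfalso; tauto)
      · intro b _ hb
        rw [if_neg]
        · simp
        · rintro ⟨h, _⟩
          exact hb (Fin.ext h)
    · rw [if_neg (by intro h; have := j.2; omega), mul_zero]
      apply Finset.sum_eq_zero
      intro b _
      rw [if_neg (by intro h; have := b.2; omega)]
      simp

lemma main_formula {N k : ℕ} (hk : 1 ≤ k) (σ : Fin k → Fin N) (p0 : Fin k)
    (τ : Fin k → Fin N) :
    ((List.ofFn fun q : Fin k => Vmat σ p0 (τ q)).reverse).prod =
        ((Real.sqrt (2 ^ k) : ℂ))⁻¹ •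
          ∑ r0 ∈ Afin σ τ, Eu k ((r0 : ℕ) + (p0 : ℕ) + 1) ((r0 : ℕ) + (p0 : ℕ) + k + 1) := by
  classical
  have e : (List.ofFn fun q : Fin k => Vmat σ p0 (τ q)).reverse =
      ((List.ofFn τ).reverse).map (Vmat σ p0) := by
    rw [List.map_reverse, List.map_ofFn]; rfl
  have hs : ((Real.sqrt (2 ^ k) : ℝ) : ℂ)⁻¹ = ((Real.sqrt 2 : ℂ))⁻¹ ^ k := by
    rw [inv_pow, ← Complex.ofReal_pow]
    congr 2
    rw [Real.sqrt_eq_iff_mul_self_eq (by positivity) (by positivity), ← mul_pow,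
      Real.mul_self_sqrt (by norm_num)]
  ext i j
  rw [e, word_prod_apply, Matrix.smul_apply, sum_Eu_apply, hs, smul_eq_mul]
  simp only [List.length_reverse, List.length_ofFn]
  congr 1
  refine if_congr (and_congr_right fun _ => ?_) rfl rfl
  have hw : ∀ q (h : q < k), (List.ofFn τ).reverse[q]'(by simpa using h) =
      τ (Fin.rev ⟨q, h⟩) := by
    intro q h
    rw [List.getElem_reverse, List.getElem_ofFn]
    congr 1
    apply Fin.ext
    simp [Fin.rev]
    omega
  constructor
  · intro h
    obtain ⟨l, hl, hil⟩ := h 0 (by omega)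
    refine ⟨l, ?_, by simpa using hil⟩
    simp only [Afin, Jfin, Finset.mem_filter, Finset.mem_univ, true_and]
    intro q
    obtain ⟨m, hm, him⟩ := h q q.2
    rw [hw q q.2] at hm
    have hmq : (m : ℕ) = l + q := by omega
    have := m.2
    refine ⟨by omega, ?_⟩
    rw [← hm]
    congr 2
    apply Fin.ext
    exact hmq.symm
  · rintro ⟨l, hl, hil⟩ q hq
    simp only [Afin, Jfin, Finset.mem_filter, Finset.mem_univ, true_and] at hl
    obtain ⟨h, h'⟩ := hl ⟨q, hq⟩
    refine ⟨⟨l + q, h⟩, ?_, ?_⟩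
    · rw [hw q hq]; exact h'
    · simp only; omega

lemma mem_Afin {N k : ℕ} (hk : 1 ≤ k) (σ τ : Fin k → Fin N) (r : Fin k) :
    r ∈ Afin σ τ ↔ (r : ℕ) = 0 ∧ τ = σ := by
  simp only [Afin, Jfin, Finset.mem_filter, Finset.mem_univ, true_and]
  constructor
  · intro h
    have h0 : (r : ℕ) = 0 := by
      obtain ⟨h1, _⟩ := h ⟨k - 1, by omega⟩
      simp only at h1
      omega
    refine ⟨h0, ?_⟩
    funext q
    obtain ⟨h1, h2⟩ := h q.rev
    rw [Fin.rev_rev] at h2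
    rw [← h2]
    congr 1
    rw [Fin.rev_eq_iff]
    apply Fin.ext
    simp [h0]
  · rintro ⟨h0, rfl⟩ q
    refine ⟨by have := q.2; omega, ?_⟩
    congr 2
    apply Fin.ext
    simp [h0]

/-- formula (apple) in the proof of Lemma 4.1(b): for every word
`τ = j_1⋯j_k`, `V_{j_k}·V_{j_{k−1}}⋯V_{j_1} = (1/√(2^k))·Σ_{r∈A_τ} E_{r+p−1, r+p+k−1}`;
in particular `V_{i_k}⋯V_{i_1} = (1/√(2^k))·E_{p,k+p}` and the product vanishes for
every word `τ ≠ σ` of length `k`. -/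
theorem stmt10 {N k : ℕ} (hN : 1 ≤ N) (hk : 1 ≤ k) (σ : Fin k → Fin N) (p0 : Fin k) :
    (∀ τ : Fin k → Fin N,
      ((List.ofFn fun q : Fin k => Vmat σ p0 (τ q)).reverse).prod =
        ((Real.sqrt (2 ^ k) : ℂ))⁻¹ •
          ∑ r0 ∈ Afin σ τ, Eu k ((r0 : ℕ) + (p0 : ℕ) + 1) ((r0 : ℕ) + (p0 : ℕ) + k + 1)) ∧
    ((List.ofFn fun q : Fin k => Vmat σ p0 (σ q)).reverse).prod =
      ((Real.sqrt (2 ^ k) : ℂ))⁻¹ • Eu k ((p0 : ℕ) + 1) (k + (p0 : ℕ) + 1) ∧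
    (∀ τ : Fin k → Fin N, τ ≠ σ →
      ((List.ofFn fun q : Fin k => Vmat σ p0 (τ q)).reverse).prod = 0) := by
  refine ⟨main_formula hk σ p0, ?_, ?_⟩
  · have hA : Afin σ σ = {(⟨0, hk⟩ : Fin k)} := by
      ext r
      rw [mem_Afin hk]
      simp [Fin.ext_iff]
    rw [main_formula hk, hA, Finset.sum_singleton]
    simp [add_comm]
  · intro τ hτ
    have hA : Afin σ τ = ∅ := by
      ext r
      rw [mem_Afin hk]
      simp [hτ]
    rw [main_formula hk, hA]
    simp
end
end

section
/- Let E be a complex Hilbert space, N ≥ 1, and Z = (Z_1,…,Z_N) ∈ B_N(E). Then I + Z_N is invertible, and, setting W_k = (I+Z_N)^{-1}Z_k for 1 ≤ k ≤ N−1 and W_N = i(I+Z_N)^{-1}(I−Z_N), one has the identity (1/(2i))·(W_N − W_N^*) − Σ_{k=1}^{N−1} W_k·W_k^* = (I+Z_N)^{-1}·(I − Σ_{k=1}^N Z_k·Z_k^*)·((I+Z_N)^{-1})^*. In particular this operator is positive and invertible, i.e. the Cayley transform C(Z) = (W_1,…,W_N) lies in the Siegel upper half-space G_N(E). -/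
noncomputable section
open scoped InnerProductSpace ComplexConjugate
open ContinuousLinearMap

variable {E : Type*} [NormedAddCommGroup E] [InnerProductSpace ℂ E] [CompleteSpace E]

/-- Membership in the Siegel upper half-space `G_N(E)` (here `N = n+1`):
`(1/(2i))(W_N − W_N^*) − Σ_{k=1}^{N−1} W_k W_k^*` is positive and invertible. -/
def inSiegel {n : ℕ} (W : Fin (n + 1) → E →L[ℂ] E) : Prop :=
  ((2 * Complex.I)⁻¹ • (W (Fin.last n) - adjoint (W (Fin.last n))) -
      ∑ k : Fin n, W k.castSucc * adjoint (W k.castSucc)).IsPositive ∧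
  IsUnit ((2 * Complex.I)⁻¹ • (W (Fin.last n) - adjoint (W (Fin.last n))) -
      ∑ k : Fin n, W k.castSucc * adjoint (W k.castSucc))

/-- The Cayley transform
`C(Z) = ((I+Z_N)⁻¹Z_1, …, (I+Z_N)⁻¹Z_{N−1}, i(I+Z_N)⁻¹(I−Z_N))`. -/
def cayley {n : ℕ} (Z : Fin (n + 1) → E →L[ℂ] E) : Fin (n + 1) → E →L[ℂ] E := fun k =>
  if k = Fin.last n then
    Complex.I • (Ring.inverse (1 + Z (Fin.last n)) * (1 - Z (Fin.last n)))
  else Ring.inverse (1 + Z (Fin.last n)) * Z k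

/-- The inverse Cayley transform
`C⁻¹(W) = (2i(iI+W_N)⁻¹W_1, …, 2i(iI+W_N)⁻¹W_{N−1}, (iI+W_N)⁻¹(iI−W_N))`. -/
def cayleyInv {n : ℕ} (W : Fin (n + 1) → E →L[ℂ] E) : Fin (n + 1) → E →L[ℂ] E := fun k =>
  if k = Fin.last n then
    Ring.inverse (Complex.I • 1 + W (Fin.last n)) * (Complex.I • 1 - W (Fin.last n))
  else (2 * Complex.I) • (Ring.inverse (Complex.I • 1 + W (Fin.last n)) * W k)

lemma aux_isUnit {A : Type*} [CStarAlgebra A] [PartialOrder A] [StarOrderedRing A] (D z : A)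
    (hD : IsStrictlyPositive D) (h : D ≤ 1 - z * star z) : IsUnit (1 + z) := by
  obtain hs | _ := subsingleton_or_nontrivial A
  · exact isUnit_of_subsingleton _
  obtain ⟨r, hr, hr_le⟩ :=
    (CFC.exists_pos_algebraMap_le_iff hD.isSelfAdjoint).2 fun x hx ↦ hD.spectrum_pos hx
  have h1 : z * star z ≤ algebraMap ℝ A (1 - r) := by
    have h2 := hr_le.trans h
    rw [map_sub, map_one]
    exact le_sub_comm.1 h2
  have h2 : z * star z ≤ algebraMap ℝ A (max (1 - r) 0) :=
    h1.trans (algebraMap_mono A (le_max_left _ _))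
  rw [← CStarAlgebra.norm_le_iff_le_algebraMap _ (le_max_right _ _) (mul_star_self_nonneg z),
    CStarRing.norm_self_mul_star] at h2
  have h3 : ‖z‖ * ‖z‖ < 1 := lt_of_le_of_lt h2 (max_lt (by linarith) one_pos)
  have h4 : ‖-z‖ < 1 := by
    rw [norm_neg]
    nlinarith [norm_nonneg z]
  simpa using isUnit_one_sub_of_norm_lt_one h4

lemma aux_identity {A : Type*} [CStarAlgebra A] {n : ℕ} (Z : Fin (n + 1) → A) (a : A)
    (ha : a * (1 + Z (Fin.last n)) = 1) :
    (2 * Complex.I)⁻¹ • (Complex.I • (a * (1 - Z (Fin.last n)))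
        - star (Complex.I • (a * (1 - Z (Fin.last n)))))
      - ∑ k : Fin n, (a * Z k.castSucc) * star (a * Z k.castSucc)
      = a * (1 - ∑ k, Z k * star (Z k)) * star a := by
  have hs : (1 + star (Z (Fin.last n))) * star a = 1 := by
    simpa using congrArg star ha
  generalize hz : Z (Fin.last n) = z at *
  have e1 : a * (1 - z) = a * ((1 - z) * (1 + star z)) * star a := by
    rw [← mul_assoc, mul_assoc (a * (1 - z)), hs, mul_one]
  have e2 : (1 - star z) * star a = a * ((1 + z) * (1 - star z)) * star a := by
    rw [← mul_assoc, ha, one_mul]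
  have e3 : star (Complex.I • (a * (1 - z))) = -(Complex.I • ((1 - star z) * star a)) := by
    simp [star_smul]
  have e4 : ∑ k : Fin n, (a * Z k.castSucc) * star (a * Z k.castSucc)
      = a * (∑ k : Fin n, Z k.castSucc * star (Z k.castSucc)) * star a := by
    simp [Finset.mul_sum, Finset.sum_mul, mul_assoc]
  have e5 : a * (1 - z) + (1 - star z) * star a
      = (2 : ℂ) • (a * (1 - z * star z) * star a) := by
    rw [e1, e2, two_smul]
    noncomm_ring
  rw [e3, e4, sub_neg_eq_add, ← smul_add, e5, smul_smul, smul_smul, Fin.sum_univ_castSucc, hz]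
  have : (2 * Complex.I)⁻¹ * (Complex.I * 2) = 1 := by
    field_simp
  rw [mul_assoc, this, one_smul]
  noncomm_ring

/-- first half of the proof of Proposition 4.2: for `Z ∈ B_N(E)`,
`I + Z_N` is invertible and, with `W = C(Z)`,
`(1/(2i))(W_N − W_N^*) − Σ_{k<N} W_k W_k^* = (I+Z_N)⁻¹ (I − Σ_k Z_k Z_k^*) ((I+Z_N)⁻¹)^*`;
in particular `C(Z) ∈ G_N(E)`. -/
theorem stmt12 {E : Type*} [NormedAddCommGroup E] [InnerProductSpace ℂ E] [CompleteSpace E]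
    {n : ℕ} (Z : Fin (n + 1) → E →L[ℂ] E) (hZ : inBall Z) :
    IsUnit (1 + Z (Fin.last n)) ∧
    ((2 * Complex.I)⁻¹ • (cayley Z (Fin.last n) - adjoint (cayley Z (Fin.last n))) -
        ∑ k : Fin n, cayley Z k.castSucc * adjoint (cayley Z k.castSucc) =
      Ring.inverse (1 + Z (Fin.last n)) * (1 - ∑ k, Z k * adjoint (Z k)) *
        adjoint (Ring.inverse (1 + Z (Fin.last n)))) ∧
    inSiegel (cayley Z) := by
  have hpos : IsStrictlyPositive (1 - ∑ k, Z k * adjoint (Z k)) :=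
    IsStrictlyPositive.iff_of_unital.2 ⟨(nonneg_iff_isPositive _).2 hZ.1, hZ.2⟩
  have hu : IsUnit (1 + Z (Fin.last n)) := by
    refine aux_isUnit _ _ hpos ?_
    refine sub_le_sub_left ?_ 1
    exact Finset.single_le_sum (f := fun k => Z k * star (Z k))
      (fun k _ => mul_star_self_nonneg (Z k)) (Finset.mem_univ (Fin.last n))
  have hid : (2 * Complex.I)⁻¹ • (cayley Z (Fin.last n) - adjoint (cayley Z (Fin.last n))) -
        ∑ k : Fin n, cayley Z k.castSucc * adjoint (cayley Z k.castSucc) =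
      Ring.inverse (1 + Z (Fin.last n)) * (1 - ∑ k, Z k * adjoint (Z k)) *
        adjoint (Ring.inverse (1 + Z (Fin.last n))) := by
    have h := aux_identity Z _ (Ring.inverse_mul_cancel _ hu)
    have hl : cayley Z (Fin.last n) =
        Complex.I • (Ring.inverse (1 + Z (Fin.last n)) * (1 - Z (Fin.last n))) := by
      simp [cayley]
    have hc : ∀ k : Fin n, cayley Z k.castSucc =
        Ring.inverse (1 + Z (Fin.last n)) * Z k.castSucc := by
      intro k
      simp [cayley, (Fin.castSucc_lt_last k).ne]
    simp only [hl, hc]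
    exact h
  refine ⟨hu, hid, ?_⟩
  unfold inSiegel
  rw [hid]
  have hi : IsUnit (Ring.inverse (1 + Z (Fin.last n))) := hu.ringInverse
  refine ⟨?_, ?_⟩
  · rw [← nonneg_iff_isPositive]
    exact star_right_conjugate_nonneg hpos.nonneg _
  · exact (hi.mul hZ.2).mul hi.star
end
end

section
/- Let E be a complex Hilbert space and N ≥ 1. The Cayley transform C, defined by C(Z) = ((I+Z_N)^{-1}Z_1, …, (I+Z_N)^{-1}Z_{N−1}, i(I+Z_N)^{-1}(I−Z_N)), is a bijection from B_N(E) onto G_N(E). Moreover, for every W ∈ G_N(E) the operator iI + W_N is invertible, and the inverse map is given explicitly by C^{-1}(W) = (2i(iI+W_N)^{-1}W_1, …, 2i(iI+W_N)^{-1}W_{N−1}, (iI+W_N)^{-1}(iI−W_N)). -/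
noncomputable section
open scoped InnerProductSpace ComplexConjugate
open ContinuousLinearMap

variable {E : Type*} [NormedAddCommGroup E] [InnerProductSpace ℂ E] [CompleteSpace E]

section helpers

theorem aux_isUnit_s13 {T : E →L[ℂ] E} (h0 : 0 ≤ T + star T) (hu : IsUnit (T + star T)) :
    IsUnit T := by
  nontriviality (E →L[ℂ] E)
  obtain ⟨r, hr, hle⟩ : ∃ r > 0, (algebraMap ℝ (E →L[ℂ] E)) r ≤ T + star T :=
    (CFC.exists_pos_algebraMap_le_iff (.of_nonneg h0)).2
      (fun x hx => lt_of_le_of_ne (spectrum_nonneg_of_nonneg h0 hx)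
        (fun h => spectrum.zero_notMem ℝ hu (h ▸ hx)))
  refine isUnit_of_forall_le_norm_inner_map T (c := (r / 2).toNNReal)
    (Real.toNNReal_pos.2 (half_pos hr)) (fun x => ?_)
  rw [ContinuousLinearMap.le_def] at hle
  have h1 := hle.re_inner_nonneg_left x
  have h2 : RCLike.re (⟪(star T) x, x⟫_ℂ) = RCLike.re (⟪T x, x⟫_ℂ) := by
    rw [star_eq_adjoint, adjoint_inner_left, ← inner_conj_symm, RCLike.conj_re]
  have h3 : RCLike.re (⟪(algebraMap ℝ (E →L[ℂ] E) r) x, x⟫_ℂ) = r * ‖x‖ ^ 2 := by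
    rw [Algebra.algebraMap_eq_smul_one]
    simp only [smul_apply, one_apply_eq_self]
    rw [← Complex.coe_smul, inner_smul_left, inner_self_eq_norm_sq_to_K]
    simp [← Complex.ofReal_pow]
  have h4 : RCLike.re (⟪T x, x⟫_ℂ) ≤ ‖⟪T x, x⟫_ℂ‖ := RCLike.re_le_norm _
  simp only [sub_apply, add_apply, inner_sub_left,
    inner_add_left, map_sub, map_add, h2, h3] at h1
  rw [Real.coe_toNNReal _ (half_pos hr).le]
  linarith

theorem aux_ball_isUnit {n : ℕ} {Z : Fin (n + 1) → E →L[ℂ] E} (h : inBall Z) :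
    IsUnit (1 + Z (Fin.last n)) := by
  obtain ⟨h1, h2⟩ := h
  have hp : IsStrictlyPositive (1 - ∑ k, Z k * adjoint (Z k)) :=
    h2.isStrictlyPositive ((nonneg_iff_isPositive _).2 h1)
  set z := Z (Fin.last n) with hz
  have hle : 1 - ∑ k, Z k * adjoint (Z k) ≤ (1 + z) + star (1 + z) := by
    have e : (1 + z) + star (1 + z) = (1 - ∑ k, Z k * adjoint (Z k)) +
        ((1 + z) * star (1 + z) + ∑ k : Fin n, Z k.castSucc * star (Z k.castSucc)) := by
      rw [Fin.sum_univ_castSucc]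
      simp only [← star_eq_adjoint, ← hz, star_add, star_one]
      noncomm_ring
    rw [e]
    exact le_add_of_nonneg_right (add_nonneg (mul_star_self_nonneg _)
      (Finset.sum_nonneg fun _ _ => mul_star_self_nonneg _))
  have := hp.of_le hle
  exact aux_isUnit_s13 this.nonneg this.isUnit

theorem aux_siegel_isUnit {n : ℕ} {W : Fin (n + 1) → E →L[ℂ] E} (h : inSiegel W) :
    IsUnit (Complex.I • (1 : E →L[ℂ] E) + W (Fin.last n)) := by
  obtain ⟨h1, -⟩ := h
  rw [← nonneg_iff_isPositive] at h1
  set w := W (Fin.last n) with hw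
  have him : 0 ≤ (2 * Complex.I)⁻¹ • (w - adjoint w) := by
    refine h1.trans (sub_le_self _ (Finset.sum_nonneg fun k _ => ?_))
    exact mul_star_self_nonneg _
  have e : (1 - Complex.I • w) + star (1 - Complex.I • w) =
      1 + (1 + ((2 * Complex.I)⁻¹ • (w - adjoint w) + (2 * Complex.I)⁻¹ • (w - adjoint w))) := by
    have hc : (2 * Complex.I)⁻¹ + (2 * Complex.I)⁻¹ = -Complex.I := by
      field_simp; simp; norm_num
    rw [← add_smul, hc]
    simp only [star_sub, star_smul, star_one, star_eq_adjoint, Complex.star_def, Complex.conj_I]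
    module
  have hsp : IsStrictlyPositive ((1 - Complex.I • w) + star (1 - Complex.I • w)) := by
    rw [e]
    exact (isUnit_one.isStrictlyPositive zero_le_one).add_nonneg (add_nonneg zero_le_one (add_nonneg him him))
  have hu := aux_isUnit_s13 hsp.nonneg hsp.isUnit
  have e2 : Complex.I • (1 : E →L[ℂ] E) + w = (Complex.I • 1) * (1 - Complex.I • w) := by
    rw [smul_mul_assoc, one_mul, smul_sub, smul_smul, Complex.I_mul_I]
    module
  rw [e2]
  refine IsUnit.mul ?_ hu
  exact (Units.mk0 Complex.I Complex.I_ne_zero • (1 : (E →L[ℂ] E)ˣ)).isUnit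

theorem aux_key {n : ℕ} (Z : Fin (n + 1) → E →L[ℂ] E) (hU : IsUnit (1 + Z (Fin.last n))) :
    (2 * Complex.I)⁻¹ • (cayley Z (Fin.last n) - adjoint (cayley Z (Fin.last n))) -
      ∑ k : Fin n, cayley Z k.castSucc * adjoint (cayley Z k.castSucc) =
    Ring.inverse (1 + Z (Fin.last n)) * (1 - ∑ k, Z k * adjoint (Z k)) *
      star (Ring.inverse (1 + Z (Fin.last n))) := by
  have hV := Ring.inverse_mul_cancel _ hU
  have hk : ∀ k : Fin n, k.castSucc ≠ Fin.last n := fun k => (Fin.castSucc_lt_last k).ne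
  rw [Fin.sum_univ_castSucc]
  simp only [cayley, if_true, hk, if_false, ← star_eq_adjoint, star_mul]
  generalize Ring.inverse (1 + Z (Fin.last n)) = V at *
  generalize Z (Fin.last n) = z at *
  have hVz : V * z = 1 - V := by
    rw [mul_add, mul_one] at hV
    exact eq_sub_of_add_eq' hV
  have hVz' : star z * star V = 1 - star V := by
    rw [← star_mul, hVz, star_sub, star_one]
  have e1 : (2 * Complex.I)⁻¹ • (Complex.I • (V * (1 - z)) - star (Complex.I • (V * (1 - z)))) =
      V + star V - 1 := by
    have : V * (1 - z) = 2 * V - 1 := by rw [mul_sub, hVz]; noncomm_ring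
    rw [this]
    have h2 : star (2 * V - 1) = 2 * star V - 1 := by
      rw [two_mul, two_mul]; simp
    rw [star_smul, h2, Complex.star_def, Complex.conj_I, neg_smul, sub_neg_eq_add, ← smul_add,
      smul_smul]
    have hc : (2 * Complex.I)⁻¹ * Complex.I = 2⁻¹ := by field_simp
    rw [hc, two_mul, two_mul]
    module
  rw [e1]
  have e2 : V * (1 - (∑ k : Fin n, Z k.castSucc * star (Z k.castSucc) + z * star z)) * star V =
      V * star V - (V * z) * (star z * star V) -
        V * (∑ k : Fin n, Z k.castSucc * star (Z k.castSucc)) * star V := by noncomm_ring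
  rw [e2, hVz, hVz', Finset.mul_sum, Finset.sum_mul]
  simp only [mul_assoc]
  noncomm_ring

theorem aux_iff {n : ℕ} (Z : Fin (n + 1) → E →L[ℂ] E) (hU : IsUnit (1 + Z (Fin.last n))) :
    inSiegel (cayley Z) ↔ inBall Z := by
  unfold inSiegel inBall
  rw [aux_key Z hU, ← nonneg_iff_isPositive, ← nonneg_iff_isPositive]
  have hV : IsUnit (Ring.inverse (1 + Z (Fin.last n))) := hU.ringInverse
  have hV' : IsUnit (star (Ring.inverse (1 + Z (Fin.last n)))) := hV.star
  rw [hV.star_right_conjugate_nonneg_iff, hV'.mul_right_iff, hV.mul_left_iff]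

theorem aux_inverse_eq {R : Type*} [Ring R] {a b : R} (h1 : a * b = 1) (h2 : b * a = 1) :
    Ring.inverse a = b :=
  Ring.inverse_unit (⟨a, b, h1, h2⟩ : Rˣ)

theorem aux_right {n : ℕ} (W : Fin (n + 1) → E →L[ℂ] E)
    (hU : IsUnit (Complex.I • (1 : E →L[ℂ] E) + W (Fin.last n))) :
    IsUnit (1 + cayleyInv W (Fin.last n)) ∧ cayley (cayleyInv W) = W := by
  have hR := Ring.inverse_mul_cancel _ hU
  have hR' := Ring.mul_inverse_cancel _ hU
  have hI : (2 * Complex.I) ≠ 0 := by simp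
  have hl : cayleyInv W (Fin.last n) = Ring.inverse (Complex.I • 1 + W (Fin.last n)) *
      (Complex.I • 1 - W (Fin.last n)) := by simp [cayleyInv]
  have hk : ∀ k, k ≠ Fin.last n → cayleyInv W k =
      (2 * Complex.I) • (Ring.inverse (Complex.I • 1 + W (Fin.last n)) * W k) := by
    intro k hk; simp [cayleyInv, hk]
  set R := Ring.inverse (Complex.I • 1 + W (Fin.last n)) with hRdef
  set w := W (Fin.last n) with hw
  have e1 : 1 + R * (Complex.I • 1 - w) = (2 * Complex.I) • R := by
    nth_rewrite 1 [← hR]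
    rw [← mul_add, show Complex.I • (1 : E →L[ℂ] E) + w + (Complex.I • 1 - w) =
      (2 * Complex.I) • 1 by module, mul_smul_comm, mul_one]
  have e2 : 1 - R * (Complex.I • 1 - w) = (2 : ℂ) • (R * w) := by
    nth_rewrite 1 [← hR]
    rw [← mul_sub, show Complex.I • (1 : E →L[ℂ] E) + w - (Complex.I • 1 - w) =
      (2 : ℂ) • w by module, mul_smul_comm]
  have m1 : ((2 * Complex.I) • R) * ((2 * Complex.I)⁻¹ • (Complex.I • 1 + w)) = 1 := by
    rw [smul_mul_smul_comm, hR, mul_inv_cancel₀ hI, one_smul]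
  have m2 : ((2 * Complex.I)⁻¹ • (Complex.I • 1 + w)) * ((2 * Complex.I) • R) = 1 := by
    rw [smul_mul_smul_comm, hR', inv_mul_cancel₀ hI, one_smul]
  have hinv := aux_inverse_eq m1 m2
  refine ⟨?_, ?_⟩
  · rw [hl, e1]
    exact ⟨⟨_, _, m1, m2⟩, rfl⟩
  · funext k
    unfold cayley
    rw [hl, e1, e2, hinv]
    split_ifs with h
    · rw [smul_mul_smul_comm, ← mul_assoc, hR', one_mul, smul_smul, h, ← hw]
      have : Complex.I * ((2 * Complex.I)⁻¹ * 2) = 1 := by field_simp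
      rw [this, one_smul]
    · rw [hk k h, smul_mul_smul_comm, ← mul_assoc (Complex.I • 1 + w), hR', one_mul, inv_mul_cancel₀ hI, one_smul]

theorem aux_left {n : ℕ} (Z : Fin (n + 1) → E →L[ℂ] E) (hU : IsUnit (1 + Z (Fin.last n))) :
    cayleyInv (cayley Z) = Z := by
  have hR := Ring.inverse_mul_cancel _ hU
  have hR' := Ring.mul_inverse_cancel _ hU
  have hI : (2 * Complex.I) ≠ 0 := by simp
  have hl : cayley Z (Fin.last n) = Complex.I • (Ring.inverse (1 + Z (Fin.last n)) *
      (1 - Z (Fin.last n))) := by simp [cayley]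
  have hk : ∀ k, k ≠ Fin.last n → cayley Z k = Ring.inverse (1 + Z (Fin.last n)) * Z k := by
    intro k hk; simp [cayley, hk]
  set V := Ring.inverse (1 + Z (Fin.last n)) with hVdef
  set z := Z (Fin.last n) with hz
  have e1 : Complex.I • 1 + Complex.I • (V * (1 - z)) = (2 * Complex.I) • V := by
    nth_rewrite 1 [← hR]
    rw [← smul_add, ← mul_add, show (1 : E →L[ℂ] E) + z + (1 - z) = (2 : ℂ) • 1 by module,
      mul_smul_comm, mul_one, smul_smul, mul_comm]
  have e2 : Complex.I • 1 - Complex.I • (V * (1 - z)) = (2 * Complex.I) • (V * z) := by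
    nth_rewrite 1 [← hR]
    rw [← smul_sub, ← mul_sub, show (1 : E →L[ℂ] E) + z - (1 - z) = (2 : ℂ) • z by module,
      mul_smul_comm, smul_smul, mul_comm Complex.I]
  have m1 : ((2 * Complex.I) • V) * ((2 * Complex.I)⁻¹ • (1 + z)) = 1 := by
    rw [smul_mul_smul_comm, hR, mul_inv_cancel₀ hI, one_smul]
  have m2 : ((2 * Complex.I)⁻¹ • (1 + z)) * ((2 * Complex.I) • V) = 1 := by
    rw [smul_mul_smul_comm, hR', inv_mul_cancel₀ hI, one_smul]
  have hinv := aux_inverse_eq m1 m2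
  funext k
  unfold cayleyInv
  rw [hl, e1, e2, hinv]
  split_ifs with h
  · rw [smul_mul_smul_comm, ← mul_assoc (1 + z), hR', one_mul, inv_mul_cancel₀ hI, one_smul, h]
  · rw [hk k h, smul_mul_assoc, ← mul_assoc, hR', one_mul, smul_smul, mul_inv_cancel₀ hI,
      one_smul]

end helpers

/-- Proposition 4.2: the Cayley transform is a bijection from `B_N(E)`
onto `G_N(E)`; for `W ∈ G_N(E)` the operator `iI + W_N` is invertible and the inverse
map is given by the explicit formula `cayleyInv`. -/
theorem stmt13 {E : Type*} [NormedAddCommGroup E] [InnerProductSpace ℂ E] [CompleteSpace E]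
    (n : ℕ) :
    Set.BijOn (cayley (E := E) (n := n)) {Z | inBall Z} {W | inSiegel W} ∧
    (∀ W : Fin (n + 1) → E →L[ℂ] E, inSiegel W →
      IsUnit (Complex.I • (1 : E →L[ℂ] E) + W (Fin.last n)) ∧ cayley (cayleyInv W) = W) ∧
    (∀ Z : Fin (n + 1) → E →L[ℂ] E, inBall Z → cayleyInv (cayley Z) = Z) := by
  have hS : ∀ W : Fin (n + 1) → E →L[ℂ] E, inSiegel W →
      inBall (cayleyInv W) ∧ cayley (cayleyInv W) = W := by
    intro W hW
    obtain ⟨hu, he⟩ := aux_right W (aux_siegel_isUnit hW)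
    refine ⟨(aux_iff _ hu).1 ?_, he⟩
    rw [he]
    exact hW
  have hB : ∀ Z : Fin (n + 1) → E →L[ℂ] E, inBall Z → cayleyInv (cayley Z) = Z :=
    fun Z hZ => aux_left Z (aux_ball_isUnit hZ)
  refine ⟨?_, fun W hW => ⟨aux_siegel_isUnit hW, (hS W hW).2⟩, hB⟩
  exact Set.InvOn.bijOn (f' := cayleyInv) ⟨fun Z hZ => hB Z hZ, fun W hW => (hS W hW).2⟩
    (fun Z hZ => (aux_iff Z (aux_ball_isUnit hZ)).2 hZ) (fun W hW => (hS W hW).1)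
end
end

section
/- Let E be a complex Hilbert space, N ≥ 1, T ∈ L(E), and Z, Z' ∈ B_N(E). Put W = C(Z) and W' = C(Z'). Then iI + W_N and −iI + (W'_N)^* are invertible and T − Σ_{k=1}^N Z_k·T·(Z'_k)^* = 4·(iI+W_N)^{-1}·( (1/(2i))·(W_N·T − T·(W'_N)^*) − Σ_{k=1}^{N−1} W_k·T·(W'_k)^* )·(−iI+(W'_N)^*)^{-1}. -/
noncomputable section
open scoped InnerProductSpace ComplexConjugate
open ContinuousLinearMap

variable {E : Type*} [NormedAddCommGroup E] [InnerProductSpace ℂ E] [CompleteSpace E]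

theorem isUnit_one_add_of_inBall {E : Type*} [NormedAddCommGroup E] [InnerProductSpace ℂ E]
    [CompleteSpace E] {N : ℕ} (Z : Fin N → E →L[ℂ] E) (hZ : inBall Z) (j : Fin N) :
    IsUnit (1 + Z j) := by
  obtain ⟨hp, hu⟩ := hZ
  rcases subsingleton_or_nontrivial (E →L[ℂ] E) with hs | hs
  · exact isUnit_of_subsingleton _
  have hp' : 0 ≤ (1 - ∑ k, Z k * adjoint (Z k)) :=
    (ContinuousLinearMap.nonneg_iff_isPositive _).2 hp
  have hsp : IsStrictlyPositive (1 - ∑ k, Z k * adjoint (Z k)) :=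
    IsStrictlyPositive.iff_of_unital.mpr ⟨hp', hu⟩
  obtain ⟨r, hr, hle⟩ := (CFC.exists_pos_algebraMap_le_iff hsp.isSelfAdjoint).2
    fun x hx => hsp.spectrum_pos hx
  have hnn : ∀ k, 0 ≤ Z k * adjoint (Z k) := fun k => mul_star_self_nonneg (Z k)
  have h1 : Z j * adjoint (Z j) ≤ ∑ k, Z k * adjoint (Z k) :=
    Finset.single_le_sum (f := fun k => Z k * adjoint (Z k)) (fun k _ => hnn k)
      (Finset.mem_univ j)
  have h2 : Z j * adjoint (Z j) ≤ algebraMap ℝ (E →L[ℂ] E) (max (1 - r) 0) := by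
    have h3 : Z j * adjoint (Z j) ≤ algebraMap ℝ (E →L[ℂ] E) (1 - r) := by
      rw [map_sub, map_one]
      exact h1.trans (le_sub_comm.1 hle)
    exact h3.trans (algebraMap_mono _ (le_max_left _ _))
  have h4 : ‖Z j * adjoint (Z j)‖ ≤ max (1 - r) 0 :=
    (CStarAlgebra.norm_le_iff_le_algebraMap _ (le_max_right _ _) (hnn j)).2 h2
  have h5 : ‖Z j * adjoint (Z j)‖ = ‖Z j‖ * ‖Z j‖ := CStarRing.norm_self_mul_star
  have h6 : max (1 - r) 0 < 1 := max_lt (by linarith) one_pos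
  have h7 : ‖-Z j‖ < 1 := by
    rw [norm_neg]
    nlinarith [norm_nonneg (Z j)]
  simpa using isUnit_one_sub_of_norm_lt_one h7

theorem cayley_last {E : Type*} [NormedAddCommGroup E] [InnerProductSpace ℂ E]
    [CompleteSpace E] {n : ℕ} (Z : Fin (n + 1) → E →L[ℂ] E)
    (h : IsUnit (1 + Z (Fin.last n))) :
    cayley Z (Fin.last n) =
      Complex.I • ((2 : ℂ) • Ring.inverse (1 + Z (Fin.last n)) - 1) := by
  have h1 := Ring.inverse_mul_cancel _ h
  have h2 : (1 - Z (Fin.last n)) = (2 : ℂ) • 1 - (1 + Z (Fin.last n)) := by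
    rw [two_smul]; abel
  simp only [cayley, if_true]
  rw [h2, mul_sub, h1, mul_smul_comm, mul_one]

theorem cayley_castSucc {E : Type*} [NormedAddCommGroup E] [InnerProductSpace ℂ E]
    [CompleteSpace E] {n : ℕ} (Z : Fin (n + 1) → E →L[ℂ] E) (k : Fin n) :
    cayley Z k.castSucc = Ring.inverse (1 + Z (Fin.last n)) * Z k.castSucc := by
  simp [cayley, (Fin.castSucc_lt_last k).ne]

/-- key step in the proof of Lemma 4.3(c): for `T ∈ L(E)` and
`Z, Z' ∈ B_N(E)` with `W = C(Z)`, `W' = C(Z')`, the operators `iI + W_N` and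
`−iI + (W'_N)^*` are invertible and
`T − Σ_k Z_k T (Z'_k)^* = 4 (iI+W_N)⁻¹ ((1/(2i))(W_N T − T (W'_N)^*) −
Σ_{k<N} W_k T (W'_k)^*) (−iI+(W'_N)^*)⁻¹`. -/
theorem stmt14 {E : Type*} [NormedAddCommGroup E] [InnerProductSpace ℂ E] [CompleteSpace E]
    {n : ℕ} (T : E →L[ℂ] E) (Z Z' : Fin (n + 1) → E →L[ℂ] E)
    (hZ : inBall Z) (hZ' : inBall Z') :
    IsUnit (Complex.I • (1 : E →L[ℂ] E) + cayley Z (Fin.last n)) ∧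
    IsUnit (-(Complex.I • (1 : E →L[ℂ] E)) + adjoint (cayley Z' (Fin.last n))) ∧
    T - ∑ k, Z k * T * adjoint (Z' k) =
      (4 : ℂ) •
        (Ring.inverse (Complex.I • (1 : E →L[ℂ] E) + cayley Z (Fin.last n)) *
          ((2 * Complex.I)⁻¹ •
              (cayley Z (Fin.last n) * T - T * adjoint (cayley Z' (Fin.last n))) -
            ∑ k : Fin n, cayley Z k.castSucc * T * adjoint (cayley Z' k.castSucc)) *
          Ring.inverse (-(Complex.I • (1 : E →L[ℂ] E)) + adjoint (cayley Z' (Fin.last n)))) := by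
  have hu := isUnit_one_add_of_inBall Z hZ (Fin.last n)
  have hu' := isUnit_one_add_of_inBall Z' hZ' (Fin.last n)
  have hW := cayley_last Z hu
  have hW' := cayley_last Z' hu'
  have hsum : ∑ k : Fin n, cayley Z k.castSucc * T * adjoint (cayley Z' k.castSucc) =
      Ring.inverse (1 + Z (Fin.last n)) *
        (∑ k : Fin n, Z k.castSucc * T * adjoint (Z' k.castSucc)) *
        adjoint (Ring.inverse (1 + Z' (Fin.last n))) := by
    rw [Finset.mul_sum, Finset.sum_mul]
    refine Finset.sum_congr rfl fun k _ => ?_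
    rw [cayley_castSucc, cayley_castSucc, ← star_eq_adjoint, ← star_eq_adjoint,
      ← star_eq_adjoint, star_mul]
    simp only [mul_assoc]
  rw [hsum, Fin.sum_univ_castSucc]
  generalize (∑ k : Fin n, Z k.castSucc * T * adjoint (Z' k.castSucc)) = S
  have a1 := Ring.inverse_mul_cancel _ hu
  have a2 := Ring.mul_inverse_cancel _ hu
  have b1 := congrArg star (Ring.mul_inverse_cancel _ hu')
  have b2 := congrArg star (Ring.inverse_mul_cancel _ hu')
  rw [star_mul, star_add, star_one] at b1 b2
  rw [hW, hW']
  simp only [← star_eq_adjoint, star_smul, star_sub, star_one]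
  generalize Ring.inverse (1 + Z (Fin.last n)) = A at *
  generalize star (Ring.inverse (1 + Z' (Fin.last n))) = B at *
  generalize Z (Fin.last n) = z at *
  generalize star (Z' (Fin.last n)) = w at *
  have e1 : Complex.I • (1 : E →L[ℂ] E) + Complex.I • ((2 : ℂ) • A - 1)
      = (2 * Complex.I) • A := by
    module
  have e2 : -(Complex.I • (1 : E →L[ℂ] E)) + star Complex.I • (star (2 : ℂ) • B - 1)
      = (-(2 * Complex.I)) • B := by
    simp only [Complex.star_def, Complex.conj_I, map_ofNat]
    module
  have hI : (2 * Complex.I) ≠ 0 := by simp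
  have hI' : -(2 * Complex.I) ≠ 0 := neg_ne_zero.2 hI
  let U : (E →L[ℂ] E)ˣ := ⟨(2 * Complex.I) • A, (2 * Complex.I)⁻¹ • (1 + z),
    by rw [smul_mul_smul_comm, a1, mul_inv_cancel₀ hI, one_smul],
    by rw [smul_mul_smul_comm, a2, inv_mul_cancel₀ hI, one_smul]⟩
  let V : (E →L[ℂ] E)ˣ := ⟨(-(2 * Complex.I)) • B, (-(2 * Complex.I))⁻¹ • (1 + w),
    by rw [smul_mul_smul_comm, b1, mul_inv_cancel₀ hI', one_smul],
    by rw [smul_mul_smul_comm, b2, inv_mul_cancel₀ hI', one_smul]⟩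
  have f1 : Ring.inverse ((2 * Complex.I) • A) = (2 * Complex.I)⁻¹ • (1 + z) :=
    Ring.inverse_unit U
  have f2 : Ring.inverse ((-(2 * Complex.I)) • B) = (-(2 * Complex.I))⁻¹ • (1 + w) :=
    Ring.inverse_unit V
  rw [e1, e2]
  refine ⟨U.isUnit, V.isUnit, ?_⟩
  rw [f1, f2]
  have e3 : (2 * Complex.I)⁻¹ • (Complex.I • ((2 : ℂ) • A - 1) * T -
      T * star Complex.I • (star (2 : ℂ) • B - 1)) = A * T + T * B - T := by
    simp only [Complex.star_def, Complex.conj_I, map_ofNat]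
    simp only [smul_mul_assoc, mul_smul_comm, sub_mul, mul_sub, one_mul, mul_one]
    rw [inv_smul_eq_iff₀ hI]
    module
  rw [e3, smul_mul_assoc, smul_mul_smul_comm, smul_smul]
  have e4 : (4 : ℂ) * ((2 * Complex.I)⁻¹ * (-(2 * Complex.I))⁻¹) = 1 := by
    rw [← mul_inv, show 2 * Complex.I * -(2 * Complex.I) = 4 by
      linear_combination (-4 : ℂ) * Complex.I_mul_I]
    norm_num
  rw [e4, one_smul]
  have g1 : (1 + z) * (A * T + T * B - T - A * S * B) * (1 + w) =
      ((1 + z) * A) * T * (1 + w) + (1 + z) * T * (B * (1 + w)) - (1 + z) * T * (1 + w)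
        - ((1 + z) * A) * S * (B * (1 + w)) := by noncomm_ring
  rw [g1, a2, b1]
  noncomm_ring
end
end

section
/- Let E be a complex Hilbert space, N ≥ 1, T ∈ L(E), and W, W' ∈ G_N(E); put Z = C^{-1}(W), Z' = C^{-1}(W') ∈ B_N(E), and D = (1/(2i))·(W_N·T − T·(W'_N)^*) − Σ_{k=1}^{N−1} W_k·T·(W'_k)^*. Then for all e, f ∈ E the family (4·⟨(iI+W_N)^{-1}·D·((iI+W'_N)^{-1})^*·(Z'_σ)^* f, (Z_σ)^* e⟩)_{σ∈F_N^+} is summable with sum ⟨T f, e⟩; that is, 4·Σ_{σ∈F_N^+} Z_σ·(iI+W_N)^{-1}·D·((iI+W'_N)^{-1})^*·(Z'_σ)^* = T in the weak operator topology. -/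
noncomputable section
open scoped InnerProductSpace ComplexConjugate
open ContinuousLinearMap

variable {E : Type*} [NormedAddCommGroup E] [InnerProductSpace ℂ E] [CompleteSpace E]

lemma pos_unit_bound (P : E →L[ℂ] E) (hP : P.IsPositive) (hu : IsUnit P) :
    ∃ r : ℝ, 0 < r ∧ ∀ x, r * ‖x‖ ^ 2 ≤ (⟪x, P x⟫_ℂ).re := by
  rcases subsingleton_or_nontrivial E with h | h
  · exact ⟨1, one_pos, fun x => by simp [Subsingleton.elim x 0]⟩
  have h0 : 0 ≤ P := (nonneg_iff_isPositive P).2 hP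
  have hs : ∀ x ∈ spectrum ℝ P, 0 < x := fun x hx =>
    lt_of_le_of_ne (spectrum_nonneg_of_nonneg h0 hx)
      (by rintro rfl; exact (spectrum.zero_notMem_iff ℝ).2 hu hx)
  obtain ⟨r, hr, hle⟩ := (CFC.exists_pos_algebraMap_le_iff (a := P) (hP.isSelfAdjoint)).2 hs
  refine ⟨r, hr, fun x => ?_⟩
  have := ((le_def _ _).1 hle).re_inner_nonneg_right x
  simp only [sub_apply, inner_sub_right, map_sub, Algebra.algebraMap_eq_smul_one, smul_apply,
    one_apply_eq_self] at this
  rw [← algebraMap_smul ℂ r x, inner_smul_right, inner_self_eq_norm_sq_to_K] at this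
  simp [← Complex.ofReal_pow] at this
  linarith

lemma unit_A {n : ℕ} (W : Fin (n + 1) → E →L[ℂ] E) (hW : inSiegel W) :
    IsUnit (Complex.I • (1 : E →L[ℂ] E) + W (Fin.last n)) := by
  refine isUnit_of_forall_le_norm_inner_map _ (c := 1) one_pos fun x => ?_
  have h := hW.1.re_inner_nonneg_right x
  have h2 : 0 ≤ ∑ k : Fin n, ‖adjoint (W k.castSucc) x‖ ^ 2 := by positivity
  simp only [sub_apply, inner_sub_right, map_sub, smul_apply, sum_apply, inner_sum, mul_apply_eq_comp,
    inner_smul_right, adjoint_inner_right, map_sum] at h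
  have h3 : ∀ k : Fin n, RCLike.re ⟪x, W k.castSucc (adjoint (W k.castSucc) x)⟫_ℂ
      = ‖adjoint (W k.castSucc) x‖ ^ 2 := fun k => by
    rw [← adjoint_inner_left, inner_self_eq_norm_sq]
  simp only [h3] at h
  rw [← inner_conj_symm x (W _ x)] at h
  simp at h
  have h6 : (⟪x, W (Fin.last n) x⟫_ℂ).im = -(⟪W (Fin.last n) x, x⟫_ℂ).im := by
    rw [← inner_conj_symm, Complex.conj_im]
  refine le_trans ?_ ((neg_le_abs _).trans (Complex.abs_im_le_norm _))
  simp [inner_add_left, inner_smul_left, inner_self_eq_norm_sq_to_K, ← Complex.ofReal_pow]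
  linarith

/-- The key algebraic identity. -/
lemma key {n : ℕ} (T : E →L[ℂ] E) (W W' : Fin (n + 1) → E →L[ℂ] E)
    (hA : IsUnit (Complex.I • (1 : E →L[ℂ] E) + W (Fin.last n)))
    (hA' : IsUnit (Complex.I • (1 : E →L[ℂ] E) + W' (Fin.last n))) :
    (4 : ℂ) • (Ring.inverse (Complex.I • (1 : E →L[ℂ] E) + W (Fin.last n)) *
              ((2 * Complex.I)⁻¹ • (W (Fin.last n) * T - T * adjoint (W' (Fin.last n))) -
                ∑ k : Fin n, W k.castSucc * T * adjoint (W' k.castSucc)) *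
              adjoint (Ring.inverse (Complex.I • (1 : E →L[ℂ] E) + W' (Fin.last n))))
    = T - ∑ k, cayleyInv W k * T * adjoint (cayleyInv W' k) := by
  set A := Complex.I • (1 : E →L[ℂ] E) + W (Fin.last n) with hAd
  set A' := Complex.I • (1 : E →L[ℂ] E) + W' (Fin.last n) with hAd'
  set R := Ring.inverse A
  set R' := Ring.inverse A'
  have hRA : R * A = 1 := Ring.inverse_mul_cancel _ hA
  have hRA' : star A' * star R' = 1 := by
    rw [← star_mul, Ring.inverse_mul_cancel _ hA', star_one]
  have hw : W (Fin.last n) = A - Complex.I • 1 := by simp [hAd]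
  have hw' : W' (Fin.last n) = A' - Complex.I • 1 := by simp [hAd']
  have hT : T = R * (A * T * star A') * star R' := by
    rw [mul_assoc, mul_assoc (A * T), hRA', mul_one, ← mul_assoc, hRA, one_mul]
  have hZ : ∀ k : Fin n, cayleyInv W k.castSucc * T * adjoint (cayleyInv W' k.castSucc)
      = R * ((4 : ℂ) • (W k.castSucc * T * star (W' k.castSucc))) * star R' := fun k => by
    have h4 : star (2 * Complex.I) * (2 * Complex.I) = 4 := by
      have h2 : (starRingEnd ℂ) 2 = 2 := Complex.conj_ofReal 2
      have hI := Complex.I_mul_I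
      simp only [RCLike.star_def, map_mul, h2, Complex.conj_I]
      linear_combination (-4) * hI
    simp only [cayleyInv, (Fin.castSucc_lt_last k).ne, if_false, ← star_eq_adjoint]
    rw [star_smul, star_mul (Ring.inverse _)]
    simp only [smul_mul_assoc, mul_smul_comm, smul_smul]
    rw [h4]
    simp only [mul_assoc]; rfl
  have hZl : cayleyInv W (Fin.last n) * T * adjoint (cayleyInv W' (Fin.last n))
      = R * ((Complex.I • 1 - W (Fin.last n)) * T * star (Complex.I • 1 - W' (Fin.last n)))
        * star R' := by
    simp only [cayleyInv, if_true, ← star_eq_adjoint, star_mul, mul_assoc]; rfl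
  rw [Fin.sum_univ_castSucc, hZl, Finset.sum_congr rfl fun k _ => hZ k, ← Finset.sum_mul,
    ← Finset.mul_sum, ← Finset.smul_sum]
  generalize hS : ∑ k : Fin n, W k.castSucc * T * star (W' k.castSucc) = S
  simp only [← star_eq_adjoint]
  have hc : (4 : ℂ) * (2 * Complex.I)⁻¹ = -2 * Complex.I := by
    field_simp; simp; norm_num
  have hmid : A * T * star A' - (Complex.I • 1 - W (Fin.last n)) * T *
      star (Complex.I • 1 - W' (Fin.last n)) - (4 : ℂ) • S = (4 : ℂ) •
      ((2 * Complex.I)⁻¹ • (W (Fin.last n) * T - T * star (W' (Fin.last n))) - S) := by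
    rw [smul_sub, smul_smul, hc, hAd, hAd']
    simp only [star_add, star_sub, star_smul, star_one, RCLike.star_def, Complex.conj_I,
      add_mul, sub_mul, mul_add, mul_sub, smul_mul_assoc, mul_smul_comm, one_mul, mul_one,
      smul_sub, smul_smul]
    module
  calc _ = R * ((4 : ℂ) •
      ((2 * Complex.I)⁻¹ • (W (Fin.last n) * T - T * star (W' (Fin.last n))) - S)) * star R' := by
        rw [mul_smul_comm, smul_mul_assoc]
    _ = R * (A * T * star A') * star R' - (R * ((4 : ℂ) • S) * star R' + R *
      ((Complex.I • 1 - W (Fin.last n)) * T * star (Complex.I • 1 - W' (Fin.last n))) * star R') := by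
        rw [← hmid]; noncomm_ring
    _ = _ := by rw [← hT]

lemma wprod_cons {N : ℕ} (Z : Fin N → E →L[ℂ] E) (i : Fin N) (l : List (Fin N)) :
    wprod Z (FreeMonoid.ofList (i :: l)) = Z i * wprod Z (FreeMonoid.ofList l) := by
  simp [wprod]

/-- Level sums. -/
def lev {N : ℕ} {M : Type*} [AddCommMonoid M] (g : List (Fin N) → M) (m : ℕ) : M :=
  ∑ v : Fin m → Fin N, g (List.ofFn v)

lemma lev_zero {N : ℕ} {M : Type*} [AddCommMonoid M] (g : List (Fin N) → M) :
    lev g 0 = g [] := by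
  simp [lev]

lemma lev_succ {N : ℕ} {M : Type*} [AddCommMonoid M] (g : List (Fin N) → M) (m : ℕ) :
    lev g (m + 1) = ∑ i, lev (fun l => g (i :: l)) m := by
  simp only [lev]
  rw [← (Fin.consEquiv (fun _ => Fin N)).sum_comp, Fintype.sum_prod_type]
  simp [Fin.consEquiv, List.ofFn_succ]

/-- matrix coefficient -/
def coef {N : ℕ} (Z Z' : Fin N → E →L[ℂ] E) (T : E →L[ℂ] E) (e f : E) (l : List (Fin N)) : ℂ :=
  ⟪adjoint (wprod Z (FreeMonoid.ofList l)) e, T (adjoint (wprod Z' (FreeMonoid.ofList l)) f)⟫_ℂ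

lemma coef_smul {N : ℕ} (Z Z' : Fin N → E →L[ℂ] E) (c : ℂ) (T : E →L[ℂ] E) (e f : E)
    (l : List (Fin N)) : coef Z Z' (c • T) e f l = c * 
      ⟪adjoint (wprod Z (FreeMonoid.ofList l)) e,
        T (adjoint (wprod Z' (FreeMonoid.ofList l)) f)⟫_ℂ := by
  simp only [coef, smul_apply, inner_smul_right]

lemma coef_cons {N : ℕ} (Z Z' : Fin N → E →L[ℂ] E) (T : E →L[ℂ] E) (e f : E)
    (i : Fin N) (l : List (Fin N)) :
    coef Z Z' T e f (i :: l) = coef Z Z' T (adjoint (Z i) e) (adjoint (Z' i) f) l := by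
  simp only [coef, wprod_cons, ← star_eq_adjoint, star_mul, mul_apply_eq_comp]

lemma lev_coef_succ {N : ℕ} (Z Z' : Fin N → E →L[ℂ] E) (T : E →L[ℂ] E) (m : ℕ) (e f : E) :
    lev (coef Z Z' T e f) (m + 1) =
      lev (coef Z Z' (∑ k, Z k * T * adjoint (Z' k)) e f) m := by
  induction m generalizing e f with
  | zero =>
    rw [lev_succ]
    simp only [lev_zero, coef_cons]
    simp [coef, wprod, sum_apply, ← star_eq_adjoint]
    refine Finset.sum_congr rfl fun i _ => ?_
    rw [star_eq_adjoint, adjoint_inner_left]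
  | succ m ih =>
    rw [lev_succ, lev_succ]
    simp only [coef_cons]
    exact Finset.sum_congr rfl fun i _ => ih _ _

lemma lev_norm_bound {N : ℕ} (Z : Fin N → E →L[ℂ] E) (r : ℝ) (hr : 0 ≤ r)
    (hZ : ∀ x, ∑ k, ‖adjoint (Z k) x‖ ^ 2 ≤ r * ‖x‖ ^ 2) (m : ℕ) (e : E) :
    lev (fun l => ‖adjoint (wprod Z (FreeMonoid.ofList l)) e‖ ^ 2) m ≤ r ^ m * ‖e‖ ^ 2 := by
  induction m generalizing e with
  | zero => simp [lev_zero, wprod, ← star_eq_adjoint]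
  | succ m ih =>
    rw [lev_succ]
    simp only [wprod_cons, ← star_eq_adjoint, star_mul, mul_apply_eq_comp]
    calc _ ≤ ∑ i, r ^ m * ‖star (Z i) e‖ ^ 2 := Finset.sum_le_sum fun i _ => ih _
      _ = r ^ m * ∑ i, ‖star (Z i) e‖ ^ 2 := by rw [Finset.mul_sum]
      _ ≤ r ^ m * (r * ‖e‖ ^ 2) := by gcongr; exact hZ e
      _ = _ := by ring

lemma coef_norm {N : ℕ} (Z Z' : Fin N → E →L[ℂ] E) (T : E →L[ℂ] E) (e f : E)
    (l : List (Fin N)) : ‖coef Z Z' T e f l‖ ≤ ‖T‖ *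
      (‖adjoint (wprod Z (FreeMonoid.ofList l)) e‖ ^ 2 +
        ‖adjoint (wprod Z' (FreeMonoid.ofList l)) f‖ ^ 2) := by
  unfold coef
  generalize adjoint (wprod Z (FreeMonoid.ofList l)) e = x
  generalize adjoint (wprod Z' (FreeMonoid.ofList l)) f = y
  calc _ ≤ ‖x‖ * (‖T‖ * ‖y‖) := (norm_inner_le_norm _ _).trans (by gcongr; exact T.le_opNorm y)
    _ = ‖T‖ * (‖x‖ * ‖y‖) := by ring
    _ ≤ _ := by gcongr; nlinarith [sq_nonneg (‖x‖ - ‖y‖), sq_nonneg ‖x‖, sq_nonneg ‖y‖]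

lemma lev_coef_norm {N : ℕ} (Z Z' : Fin N → E →L[ℂ] E) (T : E →L[ℂ] E) (e f : E)
    (r r' : ℝ) (hr : 0 ≤ r) (hr' : 0 ≤ r')
    (hZ : ∀ x, ∑ k, ‖adjoint (Z k) x‖ ^ 2 ≤ r * ‖x‖ ^ 2)
    (hZ' : ∀ x, ∑ k, ‖adjoint (Z' k) x‖ ^ 2 ≤ r' * ‖x‖ ^ 2) (m : ℕ) :
    lev (fun l => ‖coef Z Z' T e f l‖) m ≤ ‖T‖ * (r ^ m * ‖e‖ ^ 2 + r' ^ m * ‖f‖ ^ 2) := by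
  calc _ ≤ lev (fun l => ‖T‖ *
      (‖adjoint (wprod Z (FreeMonoid.ofList l)) e‖ ^ 2 +
        ‖adjoint (wprod Z' (FreeMonoid.ofList l)) f‖ ^ 2)) m :=
        Finset.sum_le_sum fun v _ => coef_norm _ _ _ _ _ _
    _ = ‖T‖ * (lev (fun l => ‖adjoint (wprod Z (FreeMonoid.ofList l)) e‖ ^ 2) m
        + lev (fun l => ‖adjoint (wprod Z' (FreeMonoid.ofList l)) f‖ ^ 2) m) := by
        simp only [lev, ← Finset.mul_sum, Finset.sum_add_distrib]
    _ ≤ _ := by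
        gcongr
        · exact lev_norm_bound Z r hr hZ m e
        · exact lev_norm_bound Z' r' hr' hZ' m f

lemma main_sum {N : ℕ} (Z Z' : Fin N → E →L[ℂ] E) (T : E →L[ℂ] E) (e f : E)
    (r r' : ℝ) (hr : 0 ≤ r) (hr' : 0 ≤ r') (h1 : r < 1) (h1' : r' < 1)
    (hZ : ∀ x, ∑ k, ‖adjoint (Z k) x‖ ^ 2 ≤ r * ‖x‖ ^ 2)
    (hZ' : ∀ x, ∑ k, ‖adjoint (Z' k) x‖ ^ 2 ≤ r' * ‖x‖ ^ 2) :
    HasSum (coef Z Z' (T - ∑ k, Z k * T * adjoint (Z' k)) e f) ⟪e, T f⟫_ℂ := by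
  set X := T - ∑ k, Z k * T * adjoint (Z' k) with hX
  have hgeo : ∀ c : ℝ, Summable fun m : ℕ => c * (r ^ m * ‖e‖ ^ 2 + r' ^ m * ‖f‖ ^ 2) := fun c =>
    (((summable_geometric_of_lt_one hr h1).mul_right _).add
      ((summable_geometric_of_lt_one hr' h1').mul_right _)).mul_left _
  have hsum : Summable fun p : (Σ m, Fin m → Fin N) => coef Z Z' X e f (List.ofFn p.2) := by
    apply Summable.of_norm
    rw [summable_sigma_of_nonneg (fun _ => norm_nonneg _)]
    refine ⟨fun m => (hasSum_fintype _).summable, ?_⟩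
    refine Summable.of_nonneg_of_le (fun m => tsum_nonneg fun _ => norm_nonneg _) (fun m => ?_)
      (hgeo ‖X‖)
    rw [tsum_fintype]
    exact lev_coef_norm Z Z' X e f r r' hr hr' hZ hZ' m
  have hlev : HasSum (fun m => lev (coef Z Z' X e f) m)
      (∑' p : (Σ m, Fin m → Fin N), coef Z Z' X e f (List.ofFn p.2)) :=
    hsum.hasSum.sigma fun m => hasSum_fintype _
  have htel : ∀ m, lev (coef Z Z' X e f) m
      = lev (coef Z Z' T e f) m - lev (coef Z Z' T e f) (m + 1) := fun m => by
    rw [lev_coef_succ]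
    simp [lev, coef, hX, inner_sub_right, sub_apply, Finset.sum_sub_distrib]
  have hto : Filter.Tendsto (fun m => lev (coef Z Z' T e f) m) Filter.atTop (nhds 0) := by
    refine squeeze_zero_norm (fun m => ?_) (hgeo ‖T‖).tendsto_atTop_zero
    exact (norm_sum_le _ _).trans (lev_coef_norm Z Z' T e f r r' hr hr' hZ hZ' m)
  have hlim := hlev.tendsto_sum_nat
  simp only [htel, Finset.sum_range_sub'] at hlim
  have heq := tendsto_nhds_unique hlim (hto.const_sub _)
  have h0 : lev (coef Z Z' T e f) 0 = ⟪e, T f⟫_ℂ := by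
    simp [lev_zero, coef, wprod, ← star_eq_adjoint]
  rw [h0, sub_zero] at heq
  have := hsum.hasSum
  rw [heq] at this
  exact (List.equivSigmaTuple.symm.hasSum_iff (f := coef Z Z' X e f)).1 this

open ComplexOrder in
lemma ball_bound {n : ℕ} (W : Fin (n + 1) → E →L[ℂ] E) (hW : inSiegel W) :
    ∃ r : ℝ, 0 ≤ r ∧ r < 1 ∧
      ∀ x, ∑ k, ‖adjoint (cayleyInv W k) x‖ ^ 2 ≤ r * ‖x‖ ^ 2 := by
  have hA := unit_A W hW
  have hk := key 1 W W hA hA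
  simp only [mul_one, one_mul] at hk
  set R := Ring.inverse (Complex.I • (1 : E →L[ℂ] E) + W (Fin.last n)) with hR
  have hRu : IsUnit R := hA.ringInverse
  obtain ⟨c, hc, hb⟩ := pos_unit_bound _
    ((hW.1.conj_adjoint R).smul_of_nonneg (c := (4 : ℂ)) (by norm_num))
    (by
      have h4 : IsUnit ((4 : ℂ) • (1 : E →L[ℂ] E)) :=
        (IsUnit.mk0 (4 : ℂ) (by norm_num)).map (algebraMap ℂ (E →L[ℂ] E)) |> fun h => by
          rwa [Algebra.algebraMap_eq_smul_one] at h
      have := h4.mul ((hRu.mul hW.2).mul hRu.star)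
      rw [smul_mul_assoc, one_mul, mul_assoc] at this
      exact this)
  refine ⟨max 0 (1 - c), le_max_left _ _, by simp [hc], fun x => ?_⟩
  have h := hb x
  have hk' := congrArg (fun S : E →L[ℂ] E => (⟪x, S x⟫_ℂ).re) hk
  have h' : c * ‖x‖ ^ 2 ≤ (⟪x, (1 - ∑ k, cayleyInv W k * adjoint (cayleyInv W k) : E →L[ℂ] E) x⟫_ℂ).re :=
    h.trans_eq hk'
  have h3 : ∀ k, (⟪x, cayleyInv W k (adjoint (cayleyInv W k) x)⟫_ℂ).re
      = ‖adjoint (cayleyInv W k) x‖ ^ 2 := fun k => by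
    rw [← adjoint_inner_left]; exact inner_self_eq_norm_sq (𝕜 := ℂ) _
  have h5 : (⟪x, x⟫_ℂ).re = ‖x‖ ^ 2 := inner_self_eq_norm_sq (𝕜 := ℂ) _
  simp only [sub_apply, inner_sub_right, sum_apply, inner_sum, mul_apply_eq_comp,
    one_apply_eq_self, Complex.sub_re, Complex.re_sum, h3, h5] at h'
  have : (1 - c) * ‖x‖ ^ 2 ≤ max 0 (1 - c) * ‖x‖ ^ 2 := by gcongr; exact le_max_right _ _
  linarith

/-- Lemma 4.3(c): for `T ∈ L(E)` and `W, W' ∈ G_N(E)`, with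
`Z = C⁻¹(W)`, `Z' = C⁻¹(W')` and
`D = (1/(2i))(W_N T − T (W'_N)^*) − Σ_{k<N} W_k T (W'_k)^*`, one has
`4·Σ_σ Z_σ (iI+W_N)⁻¹ D ((iI+W'_N)⁻¹)^* (Z'_σ)^* = T` in the weak operator topology.
Here the inner product `⟨u, v⟩` linear in `u` is written as `⟪v, u⟫_ℂ`. -/
theorem stmt16 {E : Type*} [NormedAddCommGroup E] [InnerProductSpace ℂ E] [CompleteSpace E]
    {n : ℕ} (T : E →L[ℂ] E) (W W' : Fin (n + 1) → E →L[ℂ] E)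
    (hW : inSiegel W) (hW' : inSiegel W') (e f : E) :
    HasSum
      (fun σ : Word (n + 1) =>
        4 * ⟪adjoint (wprod (cayleyInv W) σ) e,
            (Ring.inverse (Complex.I • (1 : E →L[ℂ] E) + W (Fin.last n)) *
              ((2 * Complex.I)⁻¹ • (W (Fin.last n) * T - T * adjoint (W' (Fin.last n))) -
                ∑ k : Fin n, W k.castSucc * T * adjoint (W' k.castSucc)) *
              adjoint (Ring.inverse (Complex.I • (1 : E →L[ℂ] E) + W' (Fin.last n))))
            (adjoint (wprod (cayleyInv W') σ) f)⟫_ℂ)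
      ⟪e, T f⟫_ℂ := by
  obtain ⟨r, hr, h1, hZ⟩ := ball_bound W hW
  obtain ⟨r', hr', h1', hZ'⟩ := ball_bound W' hW'
  have h := main_sum (cayleyInv W) (cayleyInv W') T e f r r' hr hr' h1 h1' hZ hZ'
  rw [← key T W W' (unit_A W hW) (unit_A W' hW')] at h
  have hfun := funext fun l : List (Fin (n + 1)) => coef_smul (cayleyInv W) (cayleyInv W') 4
    (Ring.inverse (Complex.I • (1 : E →L[ℂ] E) + W (Fin.last n)) *
              ((2 * Complex.I)⁻¹ • (W (Fin.last n) * T - T * adjoint (W' (Fin.last n))) -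
                ∑ k : Fin n, W k.castSucc * T * adjoint (W' k.castSucc)) *
              adjoint (Ring.inverse (Complex.I • (1 : E →L[ℂ] E) + W' (Fin.last n)))) e f l
  rw [hfun] at h
  exact h
end
end
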